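/- For every l ∈ ℕ there exists K = K(l) such that for all k ≥ K and all sufficiently large β (β ≥ β(l,k)), the decimated Schonmann projection ν_{l,k}^+ is a regular g-measure with summable variation: viewed as a translation-invariant process on the alphabet A = {−1,+1}^l indexed by ℤ (the j-th letter being the spins of ν_{β,0}^+ on the block [j(k+l), j(k+l)+l−1]), there is a continuous g-function P : A × A^{{…,−2,−1}} → (0,1) with ∑_{k'≥1} var_{k'}(P) < ∞ such that ν_{l,k}^+ is a g-measure consistent with P. -/

import Mathlib

open MeasureTheory Filter Topology ProbabilityTheory

noncomputable section

/-- Spin value of a Boolean spin: `true ↦ +1`, `false ↦ -1`. -/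
def sval (b : Bool) : ℝ := if b then 1 else -1

/-- Two-dimensional spin configurations. -/
abbrev Cfg2 := ℤ × ℤ → Bool

/-- Two-sided sequences over an alphabet `A`. -/
abbrev ZSeq (A : Type*) := ℤ → A

/-- Pasts: index `k` corresponds to the coordinate `-(k+1)`. -/
abbrev Past (A : Type*) := ℕ → A

/-- The four nearest neighbours of a site of `ℤ²`. -/
def nbrs (x : ℤ × ℤ) : Finset (ℤ × ℤ) :=
  {(x.1 + 1, x.2), (x.1 - 1, x.2), (x.1, x.2 + 1), (x.1, x.2 - 1)}

/-- Boltzmann weight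
`exp(β[Σ_{{x,y}⊆Λ, x∼y} ω_x ω_y + Σ_{x∈Λ, y∉Λ, x∼y} ω_x σ_y] − h Σ_{x∈Λ} ω_x)`
(the sum over unordered pairs inside `Λ` is written as half the ordered sum). -/
def isingWeight (β h : ℝ) (Λ : Finset (ℤ × ℤ)) (σ ω : Cfg2) : ℝ :=
  Real.exp (β * ((∑ x ∈ Λ, ∑ y ∈ Λ.filter (fun y => y ∈ nbrs x),
        sval (ω x) * sval (ω y)) / 2
      + ∑ x ∈ Λ, ∑ y ∈ (nbrs x).filter (fun y => y ∉ Λ), sval (ω x) * sval (σ y))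
    - h * ∑ x ∈ Λ, sval (ω x))

/-- Fill in the values `τ` inside `Λ` and `σ` outside. -/
def fill (Λ : Finset (ℤ × ℤ)) (σ : Cfg2) (τ : ↥Λ → Bool) : Cfg2 :=
  fun x => if hx : x ∈ Λ then τ ⟨x, hx⟩ else σ x

/-- The finite-volume Ising measure in `Λ` with boundary condition `σ`, viewed as a measure on
the full configuration space, the spins outside `Λ` being frozen to `σ`. -/
def isingFV (β h : ℝ) (Λ : Finset (ℤ × ℤ)) (σ : Cfg2) : Measure Cfg2 :=
  (∑ τ : ↥Λ → Bool, ENNReal.ofReal (isingWeight β h Λ σ (fill Λ σ τ)))⁻¹ •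
    ∑ τ : ↥Λ → Bool,
      ENNReal.ofReal (isingWeight β h Λ σ (fill Λ σ τ)) • Measure.dirac (fill Λ σ τ)

/-- The box `[-n,n]²`. -/
def box (n : ℕ) : Finset (ℤ × ℤ) :=
  (Finset.Icc (-(n : ℤ)) (n : ℤ)) ×ˢ (Finset.Icc (-(n : ℤ)) (n : ℤ))

/-- Convergence of a sequence of measures on a product space in the sense of convergence of the
measures of all finite-dimensional cylinder events; for probability measures on `{−1,+1}^ι`
this is exactly weak convergence. -/
def CylTendsto {ι A : Type*} [MeasurableSpace A] (μs : ℕ → Measure (ι → A))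
    (μ : Measure (ι → A)) : Prop :=
  ∀ (s : Finset ι) (f : ι → A),
    Tendsto (fun n => μs n {η | ∀ i ∈ s, η i = f i}) atTop (𝓝 (μ {η | ∀ i ∈ s, η i = f i}))

/-- `μ` is the plus phase `μ_{β,h}^+`: the weak limit of the finite-volume Ising measures on
`[-n,n]²` with all-plus boundary conditions. -/
def IsPlusPhase (β h : ℝ) (μ : Measure Cfg2) : Prop :=
  IsProbabilityMeasure μ ∧ CylTendsto (fun n => isingFV β h (box n) (fun _ => true)) μ

/-- `μ` is the minus phase `μ_{β,h}^-`. -/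
def IsMinusPhase (β h : ℝ) (μ : Measure Cfg2) : Prop :=
  IsProbabilityMeasure μ ∧ CylTendsto (fun n => isingFV β h (box n) (fun _ => false)) μ

/-- The critical inverse temperature `β_c = ln(1+√2)/2`. -/
def betaCrit : ℝ := Real.log (1 + Real.sqrt 2) / 2

/-- Projection of a two-dimensional configuration onto the line `ℤ × {0}`. -/
def lineProj (η : Cfg2) : ZSeq Bool := fun i => η (i, 0)

/-- The Schonmann projection of a measure on `{−1,+1}^{ℤ²}`. -/
def schonmann (μ : Measure Cfg2) : Measure (ZSeq Bool) := μ.map lineProj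

/-- Restriction of a two-sided sequence to its strict past; index `k` is coordinate `-(k+1)`. -/
def restrictPast {A : Type*} (ω : ZSeq A) : Past A := fun k => ω (-(k + 1 : ℤ))

/-- The shift on two-sided sequences. -/
def shiftSeq {A : Type*} : ZSeq A → ZSeq A := fun ω i => ω (i + 1)

/-- The σ-algebra `ℱ_{<0}` generated by the coordinates of negative index. -/
def pastSigma (A : Type*) [MeasurableSpace A] : MeasurableSpace (ZSeq A) :=
  MeasurableSpace.comap (fun ω : ZSeq A => restrictPast ω) inferInstance

/-- The σ-algebra generated by the coordinates in `S`. -/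
def sigmaOn {ι A : Type*} [MeasurableSpace A] (S : Set ι) : MeasurableSpace (ι → A) :=
  MeasurableSpace.comap (fun ω : ι → A => S.restrict ω) inferInstance

/-- A g-function on the alphabet `A`: measurable, `[0,1]`-valued, normalized. -/
def IsGFunction {A : Type*} [Fintype A] [MeasurableSpace A] (P : A → Past A → ℝ) : Prop :=
  (∀ a, Measurable (P a)) ∧ ∀ ω, (∑ a : A, P a ω) = 1 ∧ ∀ a, P a ω ∈ Set.Icc (0 : ℝ) 1

/-- `μ` is a translation-invariant g-measure consistent with the g-function `P`: for each `a`,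
`ω ↦ P a (restrictPast ω)` is a version of the conditional probability `μ(X₀ = a | ℱ_{<0})`. -/
def IsGMeasure {A : Type*} [MeasurableSpace A] (μ : Measure (ZSeq A))
    (P : A → Past A → ℝ) : Prop :=
  IsProbabilityMeasure μ ∧ μ.map shiftSeq = μ ∧
    ∀ a : A, (fun ω => P a (restrictPast ω))
      =ᵐ[μ] μ[Set.indicator {ω : ZSeq A | ω 0 = a} (fun _ => (1 : ℝ)) | pastSigma A]

/-- The `k`-th variation of a g-function: the supremum of `|P a ω − P a σ|` over pasts agreeing
on the coordinates `−k,…,−1`. -/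
def varG {A : Type*} (P : A → Past A → ℝ) (k : ℕ) : ℝ :=
  sSup {d : ℝ | ∃ (a : A) (ω σ' : Past A), (∀ j < k, ω j = σ' j) ∧ d = |P a ω - P a σ'|}

/-- Elementary conditional probability `μ(B | A)`, as a real number. -/
def condProbR {X : Type*} [MeasurableSpace X] (μ : Measure X) (B A : Set X) : ℝ :=
  ((μ[|A]) B).toReal

/-- The event that `η_i = ω` (suitably reindexed) for `−n ≤ i ≤ −1` and `η_i = b`
for `−(n+l) ≤ i ≤ −(n+1)`. -/
def pastEvt (n l : ℕ) (b : Bool) (ω : Past Bool) : Set (ZSeq Bool) :=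
  {η | (∀ i : ℤ, -(n : ℤ) ≤ i → i ≤ -1 → η i = ω (i.natAbs - 1)) ∧
       (∀ i : ℤ, -((n : ℤ) + l) ≤ i → i ≤ -((n : ℤ) + 1) → η i = b)}

/-- The event that `η_i = b` for `−(n+l) ≤ i ≤ −n`. -/
def blockEvt (n l : ℕ) (b : Bool) : Set (ZSeq Bool) :=
  {η | ∀ i : ℤ, -((n : ℤ) + l) ≤ i → i ≤ -(n : ℤ) → η i = b}

/-- The event that `η_i = b` for `−n ≤ i ≤ −1`. -/
def allBlock (n : ℕ) (b : Bool) : Set (ZSeq Bool) :=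
  {η | ∀ i : ℤ, -(n : ℤ) ≤ i → i ≤ -1 → η i = b}

/-- `P` is the g-function `P^{+,b}` obtained from `ν` by conditioning on the symbol `b`
in the far past: `P(a|ω) = lim_n lim_l ν(η₀ = a | η = b on [−(n+l),−(n+1)], η = ω on [−n,−1])`,
both iterated limits being required to exist. -/
def IsCondG (ν : Measure (ZSeq Bool)) (b : Bool) (P : Bool → Past Bool → ℝ) : Prop :=
  ∀ (a : Bool) (ω : Past Bool), ∃ L : ℕ → ℝ,
    (∀ n, Tendsto (fun l => condProbR ν {η | η 0 = a} (pastEvt n l b ω)) atTop (𝓝 (L n))) ∧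
    Tendsto L atTop (𝓝 (P a ω))

/-- `ν'` is the iterated weak limit `lim_n lim_l ν( · | η = b on [−(n+l),−n])`. -/
def IsCondLimitMeasure (ν : Measure (ZSeq Bool)) (b : Bool) (ν' : Measure (ZSeq Bool)) : Prop :=
  ∃ νseq : ℕ → Measure (ZSeq Bool),
    (∀ n, CylTendsto (fun l => ν[|blockEvt n l b]) (νseq n)) ∧ CylTendsto νseq ν'

/-- Stochastic domination: `ν ≤ μ` iff `ν B ≤ μ B` for every increasing measurable event `B`. -/
def StochDom {A : Type*} [MeasurableSpace A] [Preorder A]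
    (ν μ : Measure (ZSeq A)) : Prop :=
  ∀ B : Set (ZSeq A), MeasurableSet B → (∀ ⦃x y : ZSeq A⦄, x ≤ y → x ∈ B → y ∈ B) → ν B ≤ μ B

/-- `π` is the i.i.d. product measure with `π(η_i = +1) = ρ` for each coordinate. -/
def IsBernoulliProd (ρ : ℝ) (π : Measure (ZSeq Bool)) : Prop :=
  IsProbabilityMeasure π ∧ ∀ (s : Finset ℤ) (f : ℤ → Bool),
    π {η | ∀ i ∈ s, η i = f i} = ∏ i ∈ s, ENNReal.ofReal (if f i then ρ else 1 - ρ)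

/-- Splicing of pasts: coordinates `−k,…,−1` (indices `< k`) from `ω`, the rest from `σ`. -/
def splice {A : Type*} (σ ω : Past A) (k : ℕ) : Past A := fun j => if j < k then ω j else σ j

/-- `ν'` is an extreme point of the convex set of g-measures consistent with `P`. -/
def ExtremeGMeasure (ν' : Measure (ZSeq Bool)) (P : Bool → Past Bool → ℝ) : Prop :=
  IsGMeasure ν' P ∧
  ∀ ν₁ ν₂ : Measure (ZSeq Bool), IsGMeasure ν₁ P → IsGMeasure ν₂ P →
    ∀ t : ℝ, t ∈ Set.Ioo (0 : ℝ) 1 →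
      ν' = ENNReal.ofReal t • ν₁ + ENNReal.ofReal (1 - t) • ν₂ → ν₁ = ν' ∧ ν₂ = ν'

/-- The event that the spins on the line are `−1` on `{−m,…,−n} × {0}`. -/
def lineMinusEvt (n m : ℕ) : Set Cfg2 :=
  {η | ∀ i : ℤ, -(m : ℤ) ≤ i → i ≤ -(n : ℤ) → η (i, 0) = false}

/-- Nearest-neighbour adjacency in `ℤ²` (`‖x−y‖₁ = 1`). -/
def adj2 (x y : ℤ × ℤ) : Prop := (x.1 - y.1).natAbs + (x.2 - y.2).natAbs = 1

/-- The event `A_n`: there is an infinite nearest-neighbour path of `+1` spins starting at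
`(n,0)` entirely contained in the half-plane `{x ≤ n}`. -/
def plusPathEvt (n : ℕ) : Set Cfg2 :=
  {η | ∃ γ : ℕ → ℤ × ℤ, γ 0 = ((n : ℤ), 0) ∧ (∀ j, adj2 (γ j) (γ (j + 1))) ∧
    Function.Injective γ ∧ (∀ j, (γ j).1 ≤ (n : ℤ)) ∧ ∀ j, η (γ j) = true}

/-- The block map for the decimation `ν_{l,k}`: the `j`-th letter consists of the spins on
`[j(k+l), j(k+l)+l−1]`. -/
def blockMap (l k : ℕ) (η : ZSeq Bool) : ZSeq (Fin l → Bool) :=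
  fun j r => η (j * ((k : ℤ) + l) + r)

end

namespace LowTemp

/-- Sites of the square lattice. -/
abbrev Site := ℤ × ℤ

theorem mem_nbrs {x y : Site} : y ∈ nbrs x ↔ y = (x.1 + 1, x.2) ∨ y = (x.1 - 1, x.2) ∨
    y = (x.1, x.2 + 1) ∨ y = (x.1, x.2 - 1) := by
  simp [nbrs]

theorem mem_nbrs_comm {x y : Site} : y ∈ nbrs x ↔ x ∈ nbrs y := by
  obtain ⟨a, b⟩ := x
  obtain ⟨c, d⟩ := y
  simp only [mem_nbrs, Prod.mk.injEq]
  omega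

theorem card_nbrs_le (x : Site) : (nbrs x).card ≤ 4 := Finset.card_le_four

/-! ### Edge cuts -/

/-- Ordered nearest-neighbour pairs with at least one endpoint in `U`. -/
def touching (U : Finset Site) : Finset (Site × Site) :=
  U.biUnion fun x => (nbrs x).biUnion fun y => {(x, y), (y, x)}

theorem mem_touching {U : Finset Site} {e : Site × Site} :
    e ∈ touching U ↔ e.2 ∈ nbrs e.1 ∧ (e.1 ∈ U ∨ e.2 ∈ U) := by
  obtain ⟨u, v⟩ := e
  simp only [touching, Finset.mem_biUnion, Finset.mem_insert, Finset.mem_singleton,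
    Prod.mk.injEq]
  constructor
  · rintro ⟨x, hx, y, hy, ⟨rfl, rfl⟩ | ⟨rfl, rfl⟩⟩
    · exact ⟨hy, Or.inl hx⟩
    · exact ⟨mem_nbrs_comm.1 hy, Or.inr hx⟩
  · rintro ⟨h, hu | hv⟩
    · exact ⟨u, hu, v, h, Or.inl ⟨rfl, rfl⟩⟩
    · exact ⟨v, hv, u, mem_nbrs_comm.1 h, Or.inr ⟨rfl, rfl⟩⟩

theorem card_touching_le (U : Finset Site) : (touching U).card ≤ 8 * U.card := by
  calc (touching U).card ≤ U.card * 8 := by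
        refine Finset.card_biUnion_le_card_mul _ _ _ fun x _ => ?_
        calc _ ≤ (nbrs x).card * 2 :=
              Finset.card_biUnion_le_card_mul _ _ _ fun y _ => Finset.card_le_two
          _ ≤ 8 := by have := card_nbrs_le x; omega
    _ = 8 * U.card := mul_comm _ _

/-- Ordered nearest-neighbour pairs separated by `M`; every edge of the boundary of `M` occurs
in both orientations. -/
def cut (M : Finset Site) : Finset (Site × Site) :=
  (touching M).filter fun e => ¬(e.1 ∈ M ↔ e.2 ∈ M)

theorem mem_cut {M : Finset Site} {e : Site × Site} :
    e ∈ cut M ↔ e.2 ∈ nbrs e.1 ∧ ¬(e.1 ∈ M ↔ e.2 ∈ M) := by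
  simp only [cut, Finset.mem_filter, mem_touching]
  tauto

theorem card_cut_le (M : Finset Site) : (cut M).card ≤ 8 * M.card :=
  (Finset.card_filter_le _ _).trans (card_touching_le M)

theorem cut_symmDiff (M X : Finset Site) : cut (symmDiff M X) = symmDiff (cut M) (cut X) := by
  ext e
  by_cases h0 : e.2 ∈ nbrs e.1 <;> by_cases h1 : e.1 ∈ M <;> by_cases h2 : e.1 ∈ X <;>
    by_cases h3 : e.2 ∈ M <;> by_cases h4 : e.2 ∈ X <;>
    simp [mem_cut, Finset.mem_symmDiff, h0, h1, h2, h3, h4]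

theorem card_symmDiff_le {α : Type*} [DecidableEq α] (s t : Finset α) :
    (symmDiff s t).card ≤ s.card + t.card := by
  refine (Finset.card_le_card ?_).trans (Finset.card_union_le s t)
  intro e he
  simp only [Finset.mem_symmDiff, Finset.mem_union] at *
  tauto

theorem card_cut_symmDiff_le (M X : Finset Site) :
    (cut (symmDiff M X)).card ≤ (cut M).card + (cut X).card := by
  rw [cut_symmDiff]
  exact card_symmDiff_le _ _

theorem card_cut_symmDiff_of_subset {M X : Finset Site} (h : cut X ⊆ cut M) :
    (cut (symmDiff M X)).card + (cut X).card = (cut M).card := by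
  have : symmDiff (cut M) (cut X) = cut M \ cut X := by
    ext e
    have := @h e
    simp only [Finset.mem_symmDiff, Finset.mem_sdiff]
    tauto
  rw [cut_symmDiff, this, Finset.card_sdiff_add_card_eq_card h]

theorem card_cut_eq_sum {M U : Finset Site} (h : M ⊆ U) :
    (cut M).card = ∑ e ∈ touching U, if (e.1 ∈ M ↔ e.2 ∈ M) then 0 else 1 := by
  have : cut M = (touching U).filter fun e => ¬(e.1 ∈ M ↔ e.2 ∈ M) := by
    ext e
    have h1 := @h e.1
    have h2 := @h e.2
    simp only [mem_cut, Finset.mem_filter, mem_touching]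
    tauto
  rw [this, Finset.card_filter]
  exact Finset.sum_congr rfl fun e _ => by split_ifs <;> simp_all

theorem card_cut_inter_add_union (A B : Finset Site) :
    (cut (A ∩ B)).card + (cut (A ∪ B)).card ≤ (cut A).card + (cut B).card := by
  rw [card_cut_eq_sum (U := A ∪ B) (Finset.inter_subset_left.trans Finset.subset_union_left),
    card_cut_eq_sum (U := A ∪ B) subset_rfl,
    card_cut_eq_sum (U := A ∪ B) (M := A) Finset.subset_union_left,
    card_cut_eq_sum (U := A ∪ B) (M := B) Finset.subset_union_right,
    ← Finset.sum_add_distrib, ← Finset.sum_add_distrib]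
  refine Finset.sum_le_sum fun e _ => ?_
  simp only [Finset.mem_inter, Finset.mem_union]
  by_cases h1 : e.1 ∈ A <;> by_cases h2 : e.1 ∈ B <;> by_cases h3 : e.2 ∈ A <;>
    by_cases h4 : e.2 ∈ B <;> simp [h1, h2, h3, h4]

/-- Sets with no edge between them have additive cuts. -/
theorem card_cut_union_of_separated {A B : Finset Site} (hd : Disjoint A B)
    (h : ∀ x ∈ A, ∀ y ∈ nbrs x, y ∉ B) :
    (cut (A ∪ B)).card = (cut A).card + (cut B).card := by
  have hAB : A ∪ B = symmDiff A B := (Disjoint.symmDiff_eq_sup hd).symm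
  suffices hdc : Disjoint (cut A) (cut B) by
    rw [hAB, cut_symmDiff, hdc.symmDiff_eq_sup]
    exact Finset.card_union_of_disjoint hdc
  rw [Finset.disjoint_left]
  intro e he he'
  rw [mem_cut] at he he'
  by_cases h1 : e.1 ∈ A
  · have h2 : e.1 ∉ B := Finset.disjoint_left.1 hd h1
    have h3 : e.2 ∈ B := by by_contra h3; exact he'.2 (iff_of_false h2 h3)
    exact h _ h1 _ he.1 h3
  · have h2 : e.2 ∈ A := by by_contra h2; exact he.2 (iff_of_false h1 h2)
    have h3 : e.2 ∉ B := Finset.disjoint_left.1 hd h2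
    have h4 : e.1 ∈ B := by by_contra h4; exact he'.2 (iff_of_false h4 h3)
    exact h _ h2 _ (mem_nbrs_comm.1 he.1) h4

/-! ### Connectivity -/

/-- Nearest-neighbour steps inside `P`. -/
def Step (P : Set Site) (x y : Site) : Prop := y ∈ nbrs x ∧ x ∈ P ∧ y ∈ P

/-- `x` and `y` are equal or joined by a nearest-neighbour path inside `P`. -/
def Joined (P : Set Site) : Site → Site → Prop := Relation.ReflTransGen (Step P)

theorem Joined.symm {P : Set Site} {x y : Site} (h : Joined P x y) : Joined P y x := by
  have : Std.Symm (Step P) := ⟨fun a b h => ⟨mem_nbrs_comm.1 h.1, h.2.2, h.2.1⟩⟩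
  exact (Relation.ReflTransGen.stdSymm (r := Step P)).symm _ _ h

theorem Joined.trans {P : Set Site} {x y z : Site} (h : Joined P x y) (h' : Joined P y z) :
    Joined P x z := Relation.ReflTransGen.trans h h'

theorem Joined.mem {P : Set Site} {x y : Site} (h : Joined P x y) (hx : x ∈ P) : y ∈ P := by
  induction h with
  | refl => exact hx
  | tail _ h _ => exact h.2.2

/-- A path inside `P` stays in the set of points joined to its start. -/
theorem Joined.restrict {P : Set Site} {x y : Site} (h : Joined P x y) :
    Joined {z | Joined P x z} x y := by
  induction h with
  | refl => exact Relation.ReflTransGen.refl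
  | tail h1 h2 ih => exact ih.tail ⟨h2.1, h1, h1.tail h2⟩

theorem Joined.exists_coord {P : Set Site} (φ : Site → ℤ)
    (hφ : ∀ x, ∀ y ∈ nbrs x, φ y ≤ φ x + 1 ∧ φ x ≤ φ y + 1) {x y : Site} (h : Joined P x y)
    {z : ℤ} (hz : φ x ≤ z ∧ z ≤ φ y ∨ φ y ≤ z ∧ z ≤ φ x) :
    ∃ u, Joined P x u ∧ φ u = z := by
  induction h with
  | refl => exact ⟨x, Relation.ReflTransGen.refl, by omega⟩
  | @tail b c h1 h2 ih =>
    by_cases hc : φ c = z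
    · exact ⟨c, h1.tail h2, hc⟩
    · have := hφ b c h2.1
      exact ih (by omega)

/-- If a ray in `P` leads to a point, the origin of the ray is joined to it. -/
theorem joined_ray {P : Set Site} {y v : Site} (hv : y + v ∈ nbrs y)
    (h : ∀ n : ℕ, y + n • v ∈ P) (n : ℕ) : Joined P y (y + n • v) := by
  induction n with
  | zero =>
    rw [zero_smul, add_zero]
    exact Relation.ReflTransGen.refl
  | succ n ih =>
    refine ih.tail ⟨?_, h n, h (n + 1)⟩
    obtain ⟨a, b⟩ := y
    obtain ⟨c, d⟩ := v
    simp only [mem_nbrs, Prod.mk_add_mk, Prod.smul_mk, Prod.mk.injEq, nsmul_eq_mul] at *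
    push_cast
    refine hv.imp (fun h => ⟨?_, ?_⟩) (Or.imp (fun h => ⟨?_, ?_⟩) (Or.imp (fun h => ⟨?_, ?_⟩)
      (fun h => ⟨?_, ?_⟩))) <;> linarith

theorem joined_column {P : Set Site} {a : ℤ} (h : ∀ t, (a, t) ∈ P) (b c : ℤ) :
    Joined P (a, b) (a, c) := by
  have key : ∀ b c : ℤ, b ≤ c → Joined P (a, b) (a, c) := fun b c hbc => by
    have := joined_ray (P := P) (y := (a, b)) (v := (0, 1)) (by simp [mem_nbrs])
      (fun n => by simpa using h _) (c - b).toNat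
    simpa [Int.toNat_of_nonneg (sub_nonneg.2 hbc)] using this
  rcases le_total b c with hbc | hbc
  · exact key b c hbc
  · exact (key c b hbc).symm

theorem joined_row {P : Set Site} {b : ℤ} (h : ∀ t, (t, b) ∈ P) (a c : ℤ) :
    Joined P (a, b) (c, b) := by
  have key : ∀ a c : ℤ, a ≤ c → Joined P (a, b) (c, b) := fun a c hac => by
    have := joined_ray (P := P) (y := (a, b)) (v := (1, 0)) (by simp [mem_nbrs])
      (fun n => by simpa using h _) (c - a).toNat
    simpa [Int.toNat_of_nonneg (sub_nonneg.2 hac)] using this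
  rcases le_total a c with hac | hac
  · exact key a c hac
  · exact (key c a hac).symm

theorem joined_corner {P : Set Site} {R : ℤ}
    (hP : ∀ y : Site, R ≤ |y.1| ∨ R ≤ |y.2| → y ∈ P)
    {y : Site} (hy : R ≤ |y.1| ∨ R ≤ |y.2|) : Joined P y (R, R) := by
  obtain ⟨a, b⟩ := y
  have hRR : R ≤ |R| := le_abs_self R
  rcases hy with hy | hy
  · exact (joined_column (fun t => hP _ (Or.inl hy)) b R).trans
      (joined_row (fun t => hP _ (Or.inr hRR)) a R)
  · exact (joined_row (fun t => hP _ (Or.inr hy)) a R).trans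
      (joined_column (fun t => hP _ (Or.inl hRR)) b R)

open Classical in
/-- Filling the holes of a finite set. -/
theorem exists_filling (C : Finset Site) : ∃ Γ : Finset Site, C ⊆ Γ ∧
    (∀ x ∉ Γ, ∀ y ∉ Γ, Joined {z | z ∉ Γ} x y) ∧
    (∀ x ∈ Γ, ∀ y ∈ nbrs x, y ∉ Γ → x ∈ C) ∧
    (∀ y v : Site, y + v ∈ nbrs y → (∀ n : ℕ, y + n • v ∉ C) → y ∉ Γ) := by
  obtain ⟨R, hR0, hR⟩ : ∃ R : ℤ, 0 ≤ R ∧ ∀ c ∈ C, |c.1| < R ∧ |c.2| < R := by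
    refine ⟨∑ c ∈ C, (|c.1| + |c.2| + 1), Finset.sum_nonneg fun _ _ => by positivity,
      fun c hc => ?_⟩
    have := Finset.single_le_sum (f := fun c : Site => |c.1| + |c.2| + 1)
      (fun _ _ => by positivity) hc
    have h1 := abs_nonneg c.1
    have h2 := abs_nonneg c.2
    constructor <;> linarith
  have hout : ∀ y : Site, R ≤ |y.1| ∨ R ≤ |y.2| → y ∈ {z : Site | z ∉ C} := by
    intro y hy hyC
    have := hR y hyC
    omega
  set c0 : Site := (R, R)
  have hc0 : c0 ∈ {z : Site | z ∉ C} := hout _ (Or.inl (le_abs_self R))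
  refine ⟨(Finset.Ioo (-R) R ×ˢ Finset.Ioo (-R) R).filter
    fun y => ¬ Joined {z | z ∉ C} c0 y, ?_, ?_⟩
  · intro c hc
    simp only [Finset.mem_filter, Finset.mem_product, Finset.mem_Ioo]
    exact ⟨⟨abs_lt.1 (hR c hc).1, abs_lt.1 (hR c hc).2⟩, fun h => h.mem hc0 hc⟩
  have hmem : ∀ y, y ∉ (Finset.Ioo (-R) R ×ˢ Finset.Ioo (-R) R).filter
      (fun y => ¬ Joined {z | z ∉ C} c0 y) ↔ Joined {z | z ∉ C} c0 y := by
    intro y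
    constructor
    · intro h
      by_contra hj
      refine h (Finset.mem_filter.2 ⟨?_, hj⟩)
      by_contra hb
      refine hj (joined_corner hout ?_).symm
      simp only [Finset.mem_product, Finset.mem_Ioo, ← abs_lt] at hb
      omega
    · intro h h'
      exact (Finset.mem_filter.1 h').2 h
  refine ⟨?_, ?_, ?_⟩
  · have hset : {z | z ∉ (Finset.Ioo (-R) R ×ˢ Finset.Ioo (-R) R).filter
        (fun y => ¬ Joined {z | z ∉ C} c0 y)} = {z | Joined {z | z ∉ C} c0 z} := Set.ext hmem
    rw [hset]
    intro x hx y hy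
    rw [hmem] at hx hy
    exact hx.restrict.symm.trans hy.restrict
  · intro x hx y hxy hy
    rw [hmem] at hy
    by_contra hxC
    exact (not_iff_not.2 (hmem x)).1 (not_not.2 hx)
      (hy.tail ⟨mem_nbrs_comm.1 hxy, hy.mem hc0, hxC⟩)
  · intro y v hv h
    rw [hmem]
    refine (joined_ray (P := {z | z ∉ C}) hv h (|y.1| + |y.2| + R).toNat |>.trans
      (joined_corner hout ?_)).symm
    obtain ⟨a, b⟩ := y
    obtain ⟨c, d⟩ := v
    have hnn : (((|a| + |b| + R).toNat : ℕ) : ℤ) = |a| + |b| + R :=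
      Int.toNat_of_nonneg (by positivity)
    simp only [mem_nbrs, Prod.mk_add_mk, Prod.mk.injEq, Prod.smul_mk, nsmul_eq_mul, hnn] at hv ⊢
    have h1 := neg_abs_le a
    have h2 := neg_abs_le b
    have h3 := le_abs_self a
    have h4 := le_abs_self b
    have h5 := abs_nonneg a
    have h6 := abs_nonneg b
    simp only [le_abs]
    rcases hv with ⟨e1, e2⟩ | ⟨e1, e2⟩ | ⟨e1, e2⟩ | ⟨e1, e2⟩
    · obtain rfl : c = 1 := by linarith
      left; left; linarith
    · obtain rfl : c = -1 := by linarith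
      left; right; linarith
    · obtain rfl : d = 1 := by linarith
      right; left; linarith
    · obtain rfl : d = -1 := by linarith
      right; right; linarith

/-! ### Boundaries of filled connected sets are connected -/

/-- The pairs whose endpoints are, respectively, within `ℓ^∞`-distance one of those of `e`. -/
noncomputable def near (e : Site × Site) : Finset (Site × Site) :=
  (Finset.Icc (e.1.1 - 1) (e.1.1 + 1) ×ˢ Finset.Icc (e.1.2 - 1) (e.1.2 + 1)) ×ˢ
    (Finset.Icc (e.2.1 - 1) (e.2.1 + 1) ×ˢ Finset.Icc (e.2.2 - 1) (e.2.2 + 1))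

theorem mem_near {e f : Site × Site} : f ∈ near e ↔
    ((e.1.1 - 1 ≤ f.1.1 ∧ f.1.1 ≤ e.1.1 + 1) ∧ (e.1.2 - 1 ≤ f.1.2 ∧ f.1.2 ≤ e.1.2 + 1)) ∧
    ((e.2.1 - 1 ≤ f.2.1 ∧ f.2.1 ≤ e.2.1 + 1) ∧ (e.2.2 - 1 ≤ f.2.2 ∧ f.2.2 ≤ e.2.2 + 1)) := by
  simp [near]

theorem self_mem_near (e : Site × Site) : e ∈ near e := by
  rw [mem_near]; omega

theorem mem_near_comm {e f : Site × Site} : f ∈ near e ↔ e ∈ near f := by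
  simp only [mem_near]; omega

theorem card_near (e : Site × Site) : (near e).card = 81 := by
  have h : ∀ a : ℤ, a + 1 + 1 - (a - 1) = 3 := fun a => by ring
  simp [near, Finset.card_product, Int.card_Icc, h]

theorem exists_primitive (h : ℤ → ZMod 2) : ∃ g : ℤ → ZMod 2, ∀ n, g (n + 1) = g n + h n := by
  refine ⟨fun n => ∑ i ∈ Finset.Ico 0 n, h i - ∑ i ∈ Finset.Ico n 0, h i, fun n => ?_⟩
  rcases le_or_gt 0 n with hn | hn
  · have h1 : Finset.Ico 0 (n + 1) = insert n (Finset.Ico 0 n) := by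
      ext i; simp only [Finset.mem_Ico, Finset.mem_insert]; omega
    have h2 : Finset.Ico (n + 1) 0 = ∅ := Finset.Ico_eq_empty (by omega)
    have h3 : Finset.Ico n 0 = ∅ := Finset.Ico_eq_empty (by omega)
    simp only [h1, h2, h3, Finset.sum_empty, sub_zero]
    rw [Finset.sum_insert (by simp), add_comm]
  · have h1 : Finset.Ico n 0 = insert n (Finset.Ico (n + 1) 0) := by
      ext i; simp only [Finset.mem_Ico, Finset.mem_insert]; omega
    have h2 : Finset.Ico 0 (n + 1) = ∅ := Finset.Ico_eq_empty (by omega)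
    have h3 : Finset.Ico 0 n = ∅ := Finset.Ico_eq_empty (by omega)
    simp only [h1, h2, h3, Finset.sum_empty, zero_sub]
    rw [Finset.sum_insert (by simp)]
    ring

/-- A closed `ZMod 2`-valued one-form on the square lattice is exact. -/
theorem exists_potential (α : Site → Site → ZMod 2)
    (hα : ∀ a b : ℤ, α (a, b) (a + 1, b) + α (a + 1, b) (a + 1, b + 1) =
      α (a, b) (a, b + 1) + α (a, b + 1) (a + 1, b + 1))
    (hs : ∀ x y, α x y = α y x) :
    ∃ F : Site → ZMod 2, ∀ x, ∀ y ∈ nbrs x, F y = F x + α x y := by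
  obtain ⟨H, hH⟩ := exists_primitive fun a => α (a, 0) (a + 1, 0)
  choose G hG using fun a => exists_primitive fun b => α (a, b) (a, b + 1)
  let F : ℤ → ℤ → ZMod 2 := fun a b => G a b - G a 0 + H a
  have hv : ∀ a b, F a (b + 1) = F a b + α (a, b) (a, b + 1) := fun a b => by
    simp only [F, hG]; ring
  have hh : ∀ a b, F (a + 1) b = F a b + α (a, b) (a + 1, b) := fun a b => by
    induction b using Int.induction_on with
    | zero => simp [F, hH]
    | succ i ih =>
      rw [hv, hv, ih]
      linear_combination hα a i
    | pred i ih =>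
      have h1 := hv a (-i - 1)
      have h2 := hv (a + 1) (-i - 1)
      have h3 := hα a (-i - 1)
      rw [sub_add_cancel] at h1 h2 h3
      linear_combination ih + h1 - h2 - h3
  have two : ∀ z : ZMod 2, z + z = 0 := by decide
  refine ⟨fun x => F x.1 x.2, fun x y hy => ?_⟩
  obtain ⟨a, b⟩ := x
  obtain ⟨c, d⟩ := y
  simp only [mem_nbrs, Prod.mk.injEq] at hy
  rcases hy with ⟨rfl, rfl⟩ | ⟨rfl, rfl⟩ | ⟨rfl, rfl⟩ | ⟨rfl, rfl⟩
  · exact hh a _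
  · have := hh (a - 1) d
    rw [sub_add_cancel] at this
    simp only [this, hs (a, d)]
    linear_combination - two (α (a - 1, d) (a, d))
  · exact hv _ b
  · have := hv c (b - 1)
    rw [sub_add_cancel] at this
    simp only [this, hs (c, b)]
    linear_combination - two (α (c, b - 1) (c, b))

theorem cut_connected {Γ C : Finset Site} (hC : ∀ x ∈ C, ∀ y ∈ C, Joined {z | z ∈ C} x y)
    (hCΓ : C ⊆ Γ) (hD : ∀ x ∉ Γ, ∀ y ∉ Γ, Joined {z | z ∉ Γ} x y)
    (hin : ∀ x ∈ Γ, ∀ y ∈ nbrs x, y ∉ Γ → x ∈ C) {e₀ : Site × Site} (he₀ : e₀ ∈ cut Γ) :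
    ∀ e ∈ cut Γ, Relation.ReflTransGen (fun a b => b ∈ near a ∧ b ∈ cut Γ) e₀ e := by
  classical
  set E : Site × Site → Prop := Relation.ReflTransGen (fun a b => b ∈ near a ∧ b ∈ cut Γ) e₀
    with hE
  have hEcut : ∀ e, E e → e ∈ cut Γ := fun e he => by
    cases he with
    | refl => exact he₀
    | tail _ h => exact h.2
  have hstep : ∀ e f, E e → f ∈ near e → f ∈ cut Γ → E f := fun e f he hn hf => he.tail ⟨hn, hf⟩
  have hswapcut : ∀ x y : Site, (x, y) ∈ cut Γ → (y, x) ∈ cut Γ := fun x y h => by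
    rw [mem_cut] at h ⊢
    exact ⟨mem_nbrs_comm.1 h.1, fun h' => h.2 h'.symm⟩
  have hswap : ∀ x y : Site, E (x, y) → E (y, x) := fun x y h => by
    refine hstep _ _ h ?_ (hswapcut _ _ (hEcut _ h))
    have := (mem_cut.1 (hEcut _ h)).1
    obtain ⟨a, b⟩ := x
    obtain ⟨c, d⟩ := y
    simp only [mem_nbrs, Prod.mk.injEq] at this
    simp only [mem_near]
    omega
  let α : Site → Site → ZMod 2 := fun x y => if E (x, y) then 1 else 0
  let ι : Site → ZMod 2 := fun x => if x ∈ Γ then 1 else 0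
  have hαcut : ∀ x y, y ∈ nbrs x → ((x, y) ∈ cut Γ → E (x, y)) → α x y = ι x + ι y := by
    intro x y hy h
    have : E (x, y) ↔ ¬(x ∈ Γ ↔ y ∈ Γ) :=
      ⟨fun h => (mem_cut.1 (hEcut _ h)).2, fun h' => h (mem_cut.2 ⟨hy, h'⟩)⟩
    by_cases hx : x ∈ Γ <;> by_cases hy : y ∈ Γ <;> simp [α, ι, this, hx, hy]
    decide
  obtain ⟨F, hF⟩ := exists_potential α (fun a b => by
    by_cases hex : E ((a, b), (a + 1, b)) ∨ E ((a + 1, b), (a + 1, b + 1)) ∨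
        E ((a, b), (a, b + 1)) ∨ E ((a, b + 1), (a + 1, b + 1))
    · have hall : ∀ f ∈ [((a, b), (a + 1, b)), ((a + 1, b), (a + 1, b + 1)),
          ((a, b), (a, b + 1)), ((a, b + 1), (a + 1, b + 1))], f ∈ cut Γ → E f := by
        intro f hf hfc
        simp only [List.mem_cons, List.not_mem_nil, or_false] at hf
        rcases hex with h | h | h | h <;>
        · refine hstep _ _ h ?_ hfc
          rw [mem_near]
          rcases hf with rfl | rfl | rfl | rfl <;> simp only <;> omega
      rw [hαcut _ _ (by simp [mem_nbrs]) (hall _ (by simp)),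
        hαcut _ _ (by simp [mem_nbrs]) (hall _ (by simp)),
        hαcut _ _ (by simp [mem_nbrs]) (hall _ (by simp)),
        hαcut _ _ (by simp [mem_nbrs]) (hall _ (by simp))]
      generalize ι (a, b) = p, ι (a + 1, b) = q, ι (a, b + 1) = r, ι (a + 1, b + 1) = s
      revert p q r s
      decide
    · push Not at hex
      simp [α, hex])
    (fun x y => by simp only [α, show E (x, y) ↔ E (y, x) from ⟨hswap _ _, hswap _ _⟩])
  have hconst : ∀ P : Set Site, (∀ x ∈ P, ∀ y ∈ P, (x, y) ∉ cut Γ) → ∀ x y, Joined P x y →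
      F y = F x := by
    intro P hP x y h
    induction h with
    | refl => rfl
    | tail _ h ih =>
      rw [hF _ _ h.1, ih]
      simp only [α, if_neg (fun h' => hP _ h.2.1 _ h.2.2 (hEcut _ h')), add_zero]
  have hval : ∀ x y x' y', (x, y) ∈ cut Γ → (x', y') ∈ cut Γ → x ∈ Γ → x' ∈ Γ →
      α x y = α x' y' := by
    intro x y x' y' h h' hx hx'
    have h1 := mem_cut.1 h
    have h1' := mem_cut.1 h'
    have hy : y ∉ Γ := fun hy => h1.2 (iff_of_true hx hy)
    have hy' : y' ∉ Γ := fun hy => h1'.2 (iff_of_true hx' hy)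
    have e1 := hconst {z | z ∈ C} (fun u hu v hv h => (mem_cut.1 h).2
      (iff_of_true (hCΓ hu) (hCΓ hv))) x x' (hC _ (hin _ hx _ h1.1 hy) _ (hin _ hx' _ h1'.1 hy'))
    have e2 := hconst {z | z ∉ Γ} (fun u hu v hv h => (mem_cut.1 h).2 (iff_of_false hu hv))
      y y' (hD _ hy _ hy')
    have e3 := hF _ _ h1.1
    have e4 := hF _ _ h1'.1
    simp only at e3 e4
    rw [e1, e2, e3] at e4
    exact add_left_cancel e4
  have horient : ∀ e ∈ cut Γ, ∃ x y, (x, y) ∈ cut Γ ∧ x ∈ Γ ∧ (E (x, y) ↔ E e) := by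
    rintro ⟨x, y⟩ he
    by_cases hx : x ∈ Γ
    · exact ⟨x, y, he, hx, Iff.rfl⟩
    · refine ⟨y, x, hswapcut _ _ he, ?_, hswap _ _, hswap _ _⟩
      by_contra hy
      exact (mem_cut.1 he).2 (iff_of_false hx hy)
  intro e he
  obtain ⟨x, y, h1, h2, h3⟩ := horient e₀ he₀
  obtain ⟨x', y', h1', h2', h3'⟩ := horient e he
  have := hval x y x' y' h1 h1' h2 h2'
  simp only [α, if_pos (h3.2 Relation.ReflTransGen.refl)] at this
  by_contra hne
  rw [if_neg (fun h => hne (h3'.1 h))] at this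
  exact one_ne_zero this

/-! ### Counting connected edge sets -/

/-- The sets of edges visited by the `near`-walks of length `n` from `e`. -/
noncomputable def walkSets : ℕ → Site × Site → Finset (Finset (Site × Site))
  | 0, e => {{e}}
  | n + 1, e => (near e).biUnion fun f => (walkSets n f).image (insert e)

theorem card_walkSets_le (n : ℕ) (e : Site × Site) : (walkSets n e).card ≤ 81 ^ n := by
  induction n generalizing e with
  | zero => simp [walkSets]
  | succ n ih =>
    calc (walkSets (n + 1) e).card ≤ (near e).card * 81 ^ n :=
          Finset.card_biUnion_le_card_mul _ _ _ fun f _ => Finset.card_image_le.trans (ih f)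
      _ = 81 ^ (n + 1) := by rw [card_near, pow_succ, mul_comm]

theorem mem_walkSets_succ {n : ℕ} {e f : Site × Site} {S : Finset (Site × Site)}
    (hf : f ∈ near e) (hS : S ∈ walkSets n f) : insert e S ∈ walkSets (n + 1) e := by
  simp only [walkSets, Finset.mem_biUnion, Finset.mem_image]
  exact ⟨f, hf, S, hS, rfl⟩

theorem start_mem_of_mem_walkSets {n : ℕ} {e : Site × Site} {S : Finset (Site × Site)}
    (hS : S ∈ walkSets n e) : e ∈ S := by
  cases n with
  | zero => simp only [walkSets, Finset.mem_singleton] at hS; simp [hS]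
  | succ n =>
    simp only [walkSets, Finset.mem_biUnion, Finset.mem_image] at hS
    obtain ⟨_, _, _, _, rfl⟩ := hS
    exact Finset.mem_insert_self _ _

theorem walkSets_mono {m n : ℕ} (h : m ≤ n) (e : Site × Site) : walkSets m e ⊆ walkSets n e := by
  induction n, h using Nat.le_induction with
  | base => exact subset_rfl
  | succ n _ ih =>
    intro S hS
    have := mem_walkSets_succ (self_mem_near e) (ih hS)
    rwa [Finset.insert_eq_of_mem (start_mem_of_mem_walkSets hS)] at this

theorem insert_mem_walkSets {n : ℕ} {e s t : Site × Site} {S : Finset (Site × Site)}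
    (hS : S ∈ walkSets n e) (ht : t ∈ S) (hs : s ∈ near t) : insert s S ∈ walkSets (n + 2) e := by
  induction n generalizing e S with
  | zero =>
    simp only [walkSets, Finset.mem_singleton] at hS
    subst hS
    obtain rfl := Finset.mem_singleton.1 ht
    have h1 : {t} ∈ walkSets 0 t := by simp [walkSets]
    have := mem_walkSets_succ hs (mem_walkSets_succ (mem_near_comm.1 hs) h1)
    rwa [Finset.insert_comm, Finset.insert_eq_of_mem (Finset.mem_singleton_self t)] at this
  | succ n ih =>
    have hS' := hS
    simp only [walkSets, Finset.mem_biUnion, Finset.mem_image] at hS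
    obtain ⟨f, hf, S', hS'', rfl⟩ := hS
    rcases Finset.mem_insert.1 ht with rfl | ht
    · have := mem_walkSets_succ hs (mem_walkSets_succ (mem_near_comm.1 hs) hS')
      rwa [Finset.insert_comm, Finset.insert_idem] at this
    · rw [Finset.insert_comm]
      exact mem_walkSets_succ hf (ih hS'' ht)

theorem mem_walkSets_of_connected {E : Finset (Site × Site)} {e₀ : Site × Site} (he₀ : e₀ ∈ E)
    (hE : ∀ e ∈ E, Relation.ReflTransGen (fun a b => b ∈ near a ∧ b ∈ E) e₀ e) :
    E ∈ walkSets (2 * E.card) e₀ := by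
  have key : ∀ n : ℕ, n + 1 ≤ E.card → ∃ S ⊆ E, S.card = n + 1 ∧ S ∈ walkSets (2 * n) e₀ := by
    intro n
    induction n with
    | zero => exact fun _ => ⟨{e₀}, by simpa using he₀, by simp, by simp [walkSets]⟩
    | succ n ih =>
      intro hn
      obtain ⟨S, hSE, hc, hS⟩ := ih (by omega)
      obtain ⟨e, heE, heS⟩ : ∃ e ∈ E, e ∉ S := by
        by_contra hcon
        push Not at hcon
        have := Finset.card_le_card (show E ⊆ S from hcon)
        omega
      obtain ⟨t, s, ht, hs, hst, hsE⟩ : ∃ t s, t ∈ S ∧ s ∉ S ∧ s ∈ near t ∧ s ∈ E := by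
        by_contra hcon
        push Not at hcon
        refine heS ?_
        have := hE e heE
        clear heE heS
        induction this with
        | refl => exact start_mem_of_mem_walkSets hS
        | tail _ h ih =>
          by_contra hns
          exact hcon _ _ ih hns h.1 h.2
      refine ⟨insert s S, Finset.insert_subset hsE hSE, ?_, insert_mem_walkSets hS ht hst⟩
      rw [Finset.card_insert_of_notMem hs, hc]
  have hpos : 0 < E.card := Finset.card_pos.2 ⟨e₀, he₀⟩
  obtain ⟨S, hSE, hc, hS⟩ := key (E.card - 1) (by omega)
  obtain rfl := Finset.eq_of_subset_of_card_le hSE (by omega)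
  exact walkSets_mono (by omega) _ hS

/-! ### The contour surrounding a large cluster -/

theorem card_residues_le {l L : ℕ} (hL : 0 < L) (i j : ℤ) (hij : i ≤ j) :
    (((Finset.Icc i j).filter fun z : ℤ => z % L < l).card : ℤ) ≤ ((j - i) / L + 2) * l := by
  have hL' : (0 : ℤ) < L := by exact_mod_cast hL
  have h1 : ((Finset.Icc i j).filter fun z : ℤ => z % L < l).card ≤
      (Finset.Icc (i / L) (j / L) ×ˢ Finset.Ico (0 : ℤ) l).card := by
    refine Finset.card_le_card_of_injOn (fun z => (z / L, z % L)) ?_ ?_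
    · intro z hz
      have hz := Finset.mem_filter.1 (Finset.mem_coe.1 hz)
      have hz1 := Finset.mem_Icc.1 hz.1
      simp only [Finset.coe_product, Set.mem_prod, Finset.mem_coe, Finset.mem_Icc, Finset.mem_Ico]
      exact ⟨⟨Int.ediv_le_ediv hL' hz1.1, Int.ediv_le_ediv hL' hz1.2⟩,
        Int.emod_nonneg _ hL'.ne', hz.2⟩
    · intro z _ z' _ h
      simp only [Prod.mk.injEq] at h
      rw [← Int.mul_ediv_add_emod z L, ← Int.mul_ediv_add_emod z' L, h.1, h.2]
  have h2 : j / L + 1 - i / L ≤ (j - i) / L + 2 := by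
    have : i / L + (j - i) / L + 1 > j / L - 1 := by
      have e1 := Int.mul_ediv_add_emod i L
      have e2 := Int.mul_ediv_add_emod j L
      have e3 := Int.mul_ediv_add_emod (j - i) L
      have m1 := Int.emod_lt_of_pos i hL'
      have m3 := Int.emod_lt_of_pos (j - i) hL'
      have m2 := Int.emod_nonneg j hL'.ne'
      by_contra hc
      push Not at hc
      nlinarith
    omega
  have h3 : i / (L : ℤ) ≤ j / L := Int.ediv_le_ediv hL' hij
  calc (((Finset.Icc i j).filter fun z : ℤ => z % L < l).card : ℤ)
      ≤ ((Finset.Icc (i / L) (j / L) ×ˢ Finset.Ico (0 : ℤ) l).card : ℤ) := by exact_mod_cast h1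
    _ = (j / L + 1 - i / L) * l := by
        rw [Finset.card_product, Int.card_Icc, Int.card_Ico]
        push_cast
        rw [Int.toNat_of_nonneg (by omega)]
        simp
    _ ≤ _ := by gcongr

theorem exists_contour {l L : ℕ} (hL : 32 * l < L) {S Λ M : Finset Site}
    (hS : ∀ s ∈ S, s.2 = 0 ∧ s.1 % L < l)
    (hΛ : ∀ y ∉ Λ, ∃ v, y + v ∈ nbrs y ∧ ∀ n : ℕ, y + n • v ∉ Λ)
    (hM : M ⊆ Λ) {x y : Site} (hx : x ∈ M) (hxy : Joined {z | z ∈ M} x y) {d : ℕ}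
    (hd : 64 * l ≤ d) (hdist : (d : ℤ) ≤ |y.1 - x.1|) :
    ∃ Γ : Finset Site, Γ ⊆ Λ ∧ cut Γ ⊆ cut M ∧ 16 * (Γ ∩ S).card ≤ (cut Γ).card ∧
      d ≤ (cut Γ).card ∧ ∃ j ∈ Finset.range ((cut Γ).card + 1),
        cut Γ ∈ walkSets (2 * (cut Γ).card) ((x.1, x.2 + j), (x.1, x.2 + j + 1)) := by
  classical
  set C := M.filter (fun z => Joined {z | z ∈ M} x z) with hCdef
  have hCmem : ∀ z, z ∈ C ↔ Joined {z | z ∈ M} x z := fun z => by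
    rw [hCdef, Finset.mem_filter]
    exact ⟨fun h => h.2, fun h => ⟨h.mem hx, h⟩⟩
  have hCset : {z | z ∈ C} = {z | Joined {z | z ∈ M} x z} := Set.ext hCmem
  have hCM : C ⊆ M := Finset.filter_subset _ _
  have hxC : x ∈ C := (hCmem x).2 Relation.ReflTransGen.refl
  have hyC : y ∈ C := (hCmem y).2 hxy
  have hCconn : ∀ u ∈ C, ∀ v ∈ C, Joined {z | z ∈ C} u v := by
    intro u hu v hv
    rw [hCset]
    rw [hCmem] at hu hv
    exact hu.restrict.symm.trans hv.restrict
  obtain ⟨Γ, hCΓ, hD, hin, hray⟩ := exists_filling C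
  have hcutM : cut Γ ⊆ cut M := by
    have key : ∀ u v : Site, v ∈ nbrs u → u ∈ Γ → v ∉ Γ → u ∈ M ∧ v ∉ M := by
      intro u v huv hu hv
      have huC := hin u hu v huv hv
      refine ⟨hCM huC, fun hvM => hv (hCΓ ((hCmem v).2 ?_))⟩
      exact ((hCmem u).1 huC).tail ⟨huv, hCM huC, hvM⟩
    intro e he
    rw [mem_cut] at he ⊢
    refine ⟨he.1, ?_⟩
    by_cases h1 : e.1 ∈ Γ
    · have h2 : e.2 ∉ Γ := fun h2 => he.2 (iff_of_true h1 h2)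
      have := key _ _ he.1 h1 h2
      exact fun h => this.2 (h.1 this.1)
    · have h2 : e.2 ∈ Γ := by by_contra h2; exact he.2 (iff_of_false h1 h2)
      have := key _ _ (mem_nbrs_comm.1 he.1) h2 h1
      exact fun h => this.2 (h.2 this.1)
  have htop : ∀ u ∈ C, ∃ b : ℤ, u.2 ≤ b ∧ (u.1, b) ∈ C ∧ ((u.1, b), (u.1, b + 1)) ∈ cut Γ := by
    intro u hu
    obtain ⟨m, hm, hmax⟩ := Finset.exists_max_image (C.filter fun z => z.1 = u.1) (fun z => z.2)
      ⟨u, Finset.mem_filter.2 ⟨hu, rfl⟩⟩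
    obtain ⟨hmC, hm1⟩ := Finset.mem_filter.1 hm
    have hmC' : (u.1, m.2) ∈ C := by rw [← hm1]; exact hmC
    refine ⟨m.2, hmax u (Finset.mem_filter.2 ⟨hu, rfl⟩), hmC', mem_cut.2 ⟨by simp [mem_nbrs], ?_⟩⟩
    have : ((u.1, m.2 + 1) : Site) ∉ Γ := by
      refine hray _ (0, 1) (by simp [mem_nbrs]) fun n hn => ?_
      have := hmax _ (Finset.mem_filter.2 ⟨hn, by simp⟩)
      simp at this
      omega
    exact fun h => this (h.1 (hCΓ hmC'))
  have hright : ∀ u ∈ C, ∃ a : ℤ, ((a, u.2), (a + 1, u.2)) ∈ cut Γ := by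
    intro u hu
    obtain ⟨m, hm, hmax⟩ := Finset.exists_max_image (C.filter fun z => z.2 = u.2) (fun z => z.1)
      ⟨u, Finset.mem_filter.2 ⟨hu, rfl⟩⟩
    obtain ⟨hmC, hm1⟩ := Finset.mem_filter.1 hm
    have hmC' : (m.1, u.2) ∈ C := by rw [← hm1]; exact hmC
    refine ⟨m.1, mem_cut.2 ⟨by simp [mem_nbrs], ?_⟩⟩
    have : ((m.1 + 1, u.2) : Site) ∉ Γ := by
      refine hray _ (1, 0) (by simp [mem_nbrs]) fun n hn => ?_
      have := hmax _ (Finset.mem_filter.2 ⟨hn, by simp⟩)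
      simp at this
      omega
    exact fun h => this (h.1 (hCΓ hmC'))
  have hcols : (C.image Prod.fst).card ≤ (cut Γ).card := by
    refine (Finset.card_le_card fun a ha => ?_).trans
      (Finset.card_image_le (s := cut Γ) (f := fun e => e.1.1))
    obtain ⟨u, hu, rfl⟩ := Finset.mem_image.1 ha
    obtain ⟨b, _, _, hb⟩ := htop u hu
    exact Finset.mem_image.2 ⟨_, hb, rfl⟩
  have hrows : (C.image Prod.snd).card ≤ (cut Γ).card := by
    refine (Finset.card_le_card fun a ha => ?_).trans
      (Finset.card_image_le (s := cut Γ) (f := fun e => e.1.2))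
    obtain ⟨u, hu, rfl⟩ := Finset.mem_image.1 ha
    obtain ⟨b, hb⟩ := hright u hu
    exact Finset.mem_image.2 ⟨_, hb, rfl⟩
  have hφ1 : ∀ x : Site, ∀ y ∈ nbrs x, y.1 ≤ x.1 + 1 ∧ x.1 ≤ y.1 + 1 := by
    rintro ⟨a, b⟩ ⟨c, d⟩ h
    simp only [mem_nbrs, Prod.mk.injEq] at h
    simp only; omega
  have hφ2 : ∀ x : Site, ∀ y ∈ nbrs x, y.2 ≤ x.2 + 1 ∧ x.2 ≤ y.2 + 1 := by
    rintro ⟨a, b⟩ ⟨c, d⟩ h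
    simp only [mem_nbrs, Prod.mk.injEq] at h
    simp only; omega
  -- the columns of the cluster form an interval
  obtain ⟨p, hp, hpmin⟩ := Finset.exists_min_image C Prod.fst ⟨x, hxC⟩
  obtain ⟨q, hq, hqmax⟩ := Finset.exists_max_image C Prod.fst ⟨x, hxC⟩
  have hIcc : C.image Prod.fst = Finset.Icc p.1 q.1 := by
    ext z
    rw [Finset.mem_image, Finset.mem_Icc]
    constructor
    · rintro ⟨u, hu, rfl⟩
      exact ⟨hpmin u hu, hqmax u hu⟩
    · intro hz
      obtain ⟨u, hu, rfl⟩ := (hCconn p hp q hq).exists_coord Prod.fst hφ1 (Or.inl hz)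
      exact ⟨u, hu.mem hp, rfl⟩
  have hw : ((C.image Prod.fst).card : ℤ) = q.1 - p.1 + 1 := by
    have := hpmin x hxC
    have := hqmax x hxC
    rw [hIcc, Int.card_Icc, Int.toNat_of_nonneg (by omega)]
    ring
  have hdw : (d : ℤ) ≤ q.1 - p.1 := by
    have h1 := hpmin x hxC
    have h2 := hqmax x hxC
    have h3 := hpmin y hyC
    have h4 := hqmax y hyC
    exact hdist.trans (abs_le.2 ⟨by omega, by omega⟩)
  have hΓcol : ∀ u ∈ Γ, u.1 ∈ C.image Prod.fst := by
    intro u hu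
    by_contra hc
    refine hray u (0, 1) (mem_nbrs.2 (Or.inr (Or.inr (Or.inl (Prod.ext (by simp) (by simp))))))
      (fun n hn => hc ?_) hu
    exact Finset.mem_image.2 ⟨_, hn, by simp⟩
  have hΓS : ((Γ ∩ S).card : ℤ) ≤ ((q.1 - p.1) / L + 2) * l := by
    refine le_trans ?_ (card_residues_le (by omega) p.1 q.1 (by omega))
    have : (Γ ∩ S).card ≤ ((Finset.Icc p.1 q.1).filter fun z : ℤ => z % L < l).card := by
      refine Finset.card_le_card_of_injOn Prod.fst ?_ ?_
      · intro u hu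
        obtain ⟨h1, h2⟩ := Finset.mem_inter.1 (Finset.mem_coe.1 hu)
        exact Finset.mem_coe.2 (Finset.mem_filter.2 ⟨hIcc ▸ hΓcol u h1, (hS u h2).2⟩)
      · intro u hu v hv h
        have h1 := (hS u (Finset.mem_inter.1 (Finset.mem_coe.1 hu)).2).1
        have h2 := (hS v (Finset.mem_inter.1 (Finset.mem_coe.1 hv)).2).1
        exact Prod.ext h (h1.trans h2.symm)
    exact_mod_cast this
  refine ⟨Γ, ?_, hcutM, ?_, ?_, ?_⟩
  · intro u hu
    by_contra hc
    obtain ⟨v, hv, hvn⟩ := hΛ u hc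
    exact hray u v hv (fun n hn => hvn n (hM (hCM hn))) hu
  · have h1 : (L : ℤ) * ((q.1 - p.1) / L) ≤ q.1 - p.1 := Int.mul_ediv_self_le (by omega)
    have h2 : 0 ≤ (q.1 - p.1) / (L : ℤ) := Int.ediv_nonneg (by omega) (by omega)
    have h3 : (32 * l : ℤ) * ((q.1 - p.1) / L) ≤ L * ((q.1 - p.1) / L) :=
      mul_le_mul_of_nonneg_right (by omega) h2
    have h4 : (64 * l : ℤ) ≤ d := by exact_mod_cast hd
    have h5 : ((C.image Prod.fst).card : ℤ) ≤ (cut Γ).card := by exact_mod_cast hcols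
    zify
    nlinarith
  · zify at hcols ⊢
    omega
  · obtain ⟨b, hb, hbC, hbcut⟩ := htop x hxC
    refine ⟨(b - x.2).toNat, ?_, ?_⟩
    · have hsub : Finset.Icc x.2 b ⊆ C.image Prod.snd := by
        intro z hz
        obtain ⟨u, hu, rfl⟩ := (hCconn x hxC _ hbC).exists_coord Prod.snd hφ2
          (Or.inl (Finset.mem_Icc.1 hz))
        exact Finset.mem_image.2 ⟨u, hu.mem hxC, rfl⟩
      have := Finset.card_le_card hsub
      rw [Int.card_Icc] at this
      rw [Finset.mem_range]
      omega
    · rw [Int.toNat_of_nonneg (by omega)]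
      simp only [add_sub_cancel]
      exact mem_walkSets_of_connected hbcut (cut_connected hCconn hCΓ hD hin hbcut)

/-! ### The contour estimate -/

theorem cut_nonempty {M : Finset Site} (hM : M.Nonempty) : (cut M).Nonempty := by
  obtain ⟨p, hp, hmax⟩ := Finset.exists_max_image M Prod.snd hM
  refine ⟨(p, (p.1, p.2 + 1)), mem_cut.2 ⟨by simp [mem_nbrs], fun h => ?_⟩⟩
  have := hmax _ (h.1 hp)
  simp only at this
  omega

theorem cut_injective : Function.Injective cut := by
  intro M N h
  by_contra hne
  have h1 : (symmDiff M N).Nonempty := by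
    rw [Finset.nonempty_iff_ne_empty]
    exact fun h0 => hne (symmDiff_eq_bot.1 h0)
  have h2 := cut_nonempty h1
  rw [cut_symmDiff, h, symmDiff_self] at h2
  exact Finset.not_nonempty_empty h2

/-- Boltzmann weight of a set of minus spins. -/
noncomputable def wt (t : ℝ) (M : Finset Site) : ℝ := t ^ (2 * (cut M).card)

/-- Sets of minus spins in `Λ` with prescribed trace `A` on `S`. -/
def fam (Λ S A : Finset Site) : Finset (Finset Site) := Λ.powerset.filter fun M => M ∩ S = A

theorem mem_fam {Λ S A M : Finset Site} : M ∈ fam Λ S A ↔ M ⊆ Λ ∧ M ∩ S = A := by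
  simp [fam]

theorem wt_nonneg {t : ℝ} (ht : 0 ≤ t) (M : Finset Site) : 0 ≤ wt t M := pow_nonneg ht _

theorem wt_pos {t : ℝ} (ht : 0 < t) (M : Finset Site) : 0 < wt t M := pow_pos ht _

/-- Contours of length at least `d` crossing the vertical ray above `x`. -/
noncomputable def contours (Λ : Finset Site) (x : Site) (d : ℕ) : Finset (Finset Site) :=
  Λ.powerset.filter fun Γ => d ≤ (cut Γ).card ∧ ∃ j ∈ Finset.range ((cut Γ).card + 1),
    cut Γ ∈ walkSets (2 * (cut Γ).card) ((x.1, x.2 + j), (x.1, x.2 + j + 1))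

theorem card_contours_le (Λ : Finset Site) (x : Site) (d p : ℕ) :
    ((contours Λ x d).filter fun Γ => (cut Γ).card = p).card ≤ 13122 ^ p := by
  calc _ ≤ ((Finset.range (p + 1)).biUnion fun j : ℕ =>
        walkSets (2 * p) ((x.1, x.2 + j), (x.1, x.2 + j + 1))).card := by
        refine Finset.card_le_card_of_injOn cut ?_ cut_injective.injOn
        intro Γ hΓ
        simp only [contours, Finset.coe_filter, Finset.mem_filter, Set.mem_ofPred_eq] at hΓ
        obtain ⟨⟨-, -, j, hj, hw⟩, rfl⟩ := hΓ
        exact Finset.mem_coe.2 (Finset.mem_biUnion.2 ⟨j, hj, hw⟩)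
    _ ≤ (Finset.range (p + 1)).card * 81 ^ (2 * p) :=
        Finset.card_biUnion_le_card_mul _ _ _ fun j _ => card_walkSets_le _ _
    _ ≤ 2 ^ p * 81 ^ (2 * p) := by
        rw [Finset.card_range]
        exact Nat.mul_le_mul_right _ Nat.lt_two_pow_self
    _ = 13122 ^ p := by rw [pow_mul, ← mul_pow]; norm_num

theorem sum_contours_le (Λ : Finset Site) (x : Site) (d : ℕ) {t : ℝ} (ht : 0 ≤ t)
    (ht2 : 13122 * t ≤ 1 / 2) :
    ∑ Γ ∈ contours Λ x d, t ^ (cut Γ).card ≤ 2 * (1 / 2) ^ d := by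
  obtain ⟨N, hN⟩ : ∃ N, ∀ Γ ∈ contours Λ x d, (cut Γ).card ∈ Finset.Ico d (d + N) := by
    refine ⟨8 * Λ.card + 1, fun Γ hΓ => ?_⟩
    simp only [contours, Finset.mem_filter, Finset.mem_powerset] at hΓ
    have := card_cut_le Γ
    have := Finset.card_le_card hΓ.1
    have := hΓ.2.1
    rw [Finset.mem_Ico]
    omega
  rw [← Finset.sum_fiberwise_of_maps_to hN]
  calc _ ≤ ∑ p ∈ Finset.Ico d (d + N), (1 / 2 : ℝ) ^ p := by
        refine Finset.sum_le_sum fun p _ => ?_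
        calc _ = ∑ Γ ∈ (contours Λ x d).filter fun Γ => (cut Γ).card = p, t ^ p :=
              Finset.sum_congr rfl fun Γ hΓ => by rw [(Finset.mem_filter.1 hΓ).2]
          _ = ((contours Λ x d).filter fun Γ => (cut Γ).card = p).card * t ^ p := by
              rw [Finset.sum_const, nsmul_eq_mul]
          _ ≤ (13122 ^ p : ℕ) * t ^ p := by
              gcongr
              exact card_contours_le Λ x d p
          _ = (13122 * t) ^ p := by push_cast; rw [mul_pow]
          _ ≤ (1 / 2) ^ p := by gcongr
    _ = (1 / 2) ^ d * ∑ p ∈ Finset.range N, (1 / 2 : ℝ) ^ p := by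
        rw [Finset.sum_Ico_eq_sum_range, Finset.mul_sum, Nat.add_sub_cancel_left]
        exact Finset.sum_congr rfl fun p _ => pow_add _ _ _
    _ ≤ (1 / 2) ^ d * 2 := by
        gcongr
        have := Summable.sum_le_tsum (f := fun p : ℕ => (1 / 2 : ℝ) ^ p) (Finset.range N)
          (fun _ _ => by positivity) summable_geometric_two
        rwa [tsum_geometric_two] at this
    _ = 2 * (1 / 2) ^ d := mul_comm _ _

/-- Erasing a contour while keeping the trace on `S`. -/
theorem wt_le_of_contour {S M Γ : Finset Site} {t : ℝ} (ht : 0 ≤ t) (ht1 : t ≤ 1)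
    (hcut : cut Γ ⊆ cut M) (hS : 16 * (Γ ∩ S).card ≤ (cut Γ).card) :
    wt t M ≤ t ^ (cut Γ).card * wt t (symmDiff M (Γ \ S)) := by
  have h0 : Γ \ S = symmDiff Γ (Γ ∩ S) := by
    ext e
    simp only [Finset.mem_sdiff, Finset.mem_symmDiff, Finset.mem_inter]
    tauto
  rw [h0, ← symmDiff_assoc, wt, wt, ← pow_add]
  refine pow_le_pow_of_le_one ht ht1 ?_
  have h1 := card_cut_symmDiff_le (symmDiff M Γ) (Γ ∩ S)
  have h2 := card_cut_symmDiff_of_subset hcut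
  have h3 := card_cut_le (Γ ∩ S)
  omega

open Classical in
theorem sum_long_cluster_le {l L : ℕ} (hL : 32 * l < L) {S Λ : Finset Site}
    (hS : ∀ s ∈ S, s.2 = 0 ∧ s.1 % L < l)
    (hΛ : ∀ y ∉ Λ, ∃ v, y + v ∈ nbrs y ∧ ∀ n : ℕ, y + n • v ∉ Λ) (A : Finset Site)
    (x : Site) {d : ℕ} (hd : 64 * l ≤ d) {t : ℝ} (ht : 0 ≤ t) (ht2 : 13122 * t ≤ 1 / 2) :
    ∑ M ∈ (fam Λ S A).filter (fun M => x ∈ M ∧ ∃ y, Joined {z | z ∈ M} x y ∧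
      (d : ℤ) ≤ |y.1 - x.1|), wt t M ≤ 2 * (1 / 2) ^ d * ∑ M ∈ fam Λ S A, wt t M := by
  set bad := (fam Λ S A).filter (fun M => x ∈ M ∧ ∃ y, Joined {z | z ∈ M} x y ∧
      (d : ℤ) ≤ |y.1 - x.1|) with hbad
  calc ∑ M ∈ bad, wt t M
      ≤ ∑ M ∈ bad, ∑ Γ ∈ contours Λ x d,
          t ^ (cut Γ).card * (wt t (symmDiff M (Γ \ S))) := by
        refine Finset.sum_le_sum fun M hM => ?_
        obtain ⟨hMf, hx, y, hxy, hy⟩ := Finset.mem_filter.1 hM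
        obtain ⟨Γ, h1, h2, h3, h4, h5⟩ := exists_contour hL hS hΛ (mem_fam.1 hMf).1 hx hxy hd hy
        have hΓ : Γ ∈ contours Λ x d :=
          Finset.mem_filter.2 ⟨Finset.mem_powerset.2 h1, h4, h5⟩
        exact (wt_le_of_contour ht (by linarith) h2 h3).trans
          (Finset.single_le_sum (f := fun Γ => t ^ (cut Γ).card * (wt t (symmDiff M (Γ \ S))))
            (fun _ _ => mul_nonneg (pow_nonneg ht _) (wt_nonneg ht _)) hΓ)
    _ = ∑ Γ ∈ contours Λ x d, t ^ (cut Γ).card * ∑ M ∈ bad, wt t (symmDiff M (Γ \ S)) := by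
        rw [Finset.sum_comm]
        exact Finset.sum_congr rfl fun _ _ => (Finset.mul_sum _ _ _).symm
    _ ≤ ∑ Γ ∈ contours Λ x d, t ^ (cut Γ).card * ∑ M ∈ fam Λ S A, wt t M := by
        refine Finset.sum_le_sum fun Γ hΓ => mul_le_mul_of_nonneg_left ?_ (pow_nonneg ht _)
        have hΓΛ : Γ ⊆ Λ := Finset.mem_powerset.1 (Finset.mem_filter.1 hΓ).1
        rw [← Finset.sum_image (f := wt t) (g := fun M => symmDiff M (Γ \ S))
          (fun M _ N _ h => symmDiff_left_injective _ h)]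
        refine Finset.sum_le_sum_of_subset_of_nonneg ?_ fun _ _ _ => wt_nonneg ht _
        intro N hN
        obtain ⟨M, hM, rfl⟩ := Finset.mem_image.1 hN
        obtain ⟨hMΛ, hMS⟩ := mem_fam.1 (Finset.mem_filter.1 hM).1
        refine mem_fam.2 ⟨fun u hu => ?_, ?_⟩
        · simp only [Finset.mem_symmDiff, Finset.mem_sdiff] at hu
          rcases hu with hu | hu
          · exact hMΛ hu.1
          · exact hΓΛ hu.1.1
        · rw [← hMS]
          ext u
          simp only [Finset.mem_symmDiff, Finset.mem_sdiff, Finset.mem_inter]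
          tauto
    _ = (∑ Γ ∈ contours Λ x d, t ^ (cut Γ).card) * ∑ M ∈ fam Λ S A, wt t M :=
        (Finset.sum_mul _ _ _).symm
    _ ≤ _ := mul_le_mul_of_nonneg_right (sum_contours_le Λ x d ht ht2)
        (Finset.sum_nonneg fun _ _ => wt_nonneg ht _)

/-! ### Positive association and sensitivity to the conditioning -/

open scoped FinsetFamily in
theorem holley {t : ℝ} (ht : 0 ≤ t) (ht1 : t ≤ 1) {g : Finset Site → ℝ} (hg : Monotone g)
    (hg0 : ∀ M, 0 ≤ g M) {Λ : Finset Site} {F G : Finset (Finset Site)}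
    (hF : ∀ M ∈ F, M ⊆ Λ) (hG : ∀ M ∈ G, M ⊆ Λ)
    (h : ∀ R ∈ F, ∀ M ∈ G, R ∩ M ∈ F ∧ R ∪ M ∈ G) :
    (∑ M ∈ F, wt t M * g M) * ∑ M ∈ G, wt t M ≤
      (∑ M ∈ F, wt t M) * ∑ M ∈ G, wt t M * g M := by
  have hw := wt_nonneg ht
  refine (Finset.four_functions_theorem (f₁ := fun M => wt t M * g M) (f₂ := wt t) (f₃ := wt t)
    (f₄ := fun M => wt t M * g M) Λ (fun M => mul_nonneg (hw M) (hg0 M)) hw hw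
    (fun M => mul_nonneg (hw M) (hg0 M)) ?_ (𝒜 := F) (ℬ := G) ?_ ?_).trans ?_
  · intro R _ M _
    have h1 : wt t R * wt t M ≤ wt t (R ∩ M) * wt t (R ∪ M) := by
      rw [wt, wt, wt, wt, ← pow_add, ← pow_add]
      refine pow_le_pow_of_le_one ht ht1 ?_
      have := card_cut_inter_add_union R M
      omega
    calc wt t R * g R * wt t M = wt t R * wt t M * g R := by ring
      _ ≤ wt t (R ∩ M) * wt t (R ∪ M) * g (R ∪ M) :=
          mul_le_mul h1 (hg Finset.subset_union_left) (hg0 _) (mul_nonneg (hw _) (hw _))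
      _ = _ := by ring
  · exact fun M hM => Finset.mem_powerset.2 (hF M hM)
  · exact fun M hM => Finset.mem_powerset.2 (hG M hM)
  · refine mul_le_mul (Finset.sum_le_sum_of_subset_of_nonneg ?_ fun M _ _ => hw M)
      (Finset.sum_le_sum_of_subset_of_nonneg ?_ fun M _ _ => mul_nonneg (hw M) (hg0 M))
      (Finset.sum_nonneg fun M _ => mul_nonneg (hw M) (hg0 M)) (Finset.sum_nonneg fun M _ => hw M)
    · intro X hX
      obtain ⟨R, hR, M, hM, rfl⟩ := Finset.mem_infs.1 hX
      exact (h R hR M hM).1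
    · intro X hX
      obtain ⟨R, hR, M, hM, rfl⟩ := Finset.mem_sups.1 hX
      exact (h R hR M hM).2

open Classical in
/-- The part of `M` joined inside `M` to `B`. -/
noncomputable def cluster (B M : Finset Site) : Finset Site :=
  M.filter fun y => ∃ b ∈ B, Joined {z | z ∈ M} b y

theorem mem_cluster {B M : Finset Site} {y : Site} :
    y ∈ cluster B M ↔ y ∈ M ∧ ∃ b ∈ B, Joined {z | z ∈ M} b y := by
  simp [cluster]

theorem Joined.mono {P Q : Set Site} (hPQ : P ⊆ Q) {x y : Site} (h : Joined P x y) :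
    Joined Q x y :=
  Relation.ReflTransGen.mono (fun _ _ h => ⟨h.1, hPQ h.2.1, hPQ h.2.2⟩) _ _ h

theorem cluster_sdiff_separated (B M : Finset Site) :
    ∀ x ∈ M \ cluster B M, ∀ y ∈ nbrs x, y ∉ cluster B M := by
  intro x hx y hxy hy
  obtain ⟨hxM, hxc⟩ := Finset.mem_sdiff.1 hx
  obtain ⟨hyM, b, hb, hby⟩ := mem_cluster.1 hy
  exact hxc (mem_cluster.2 ⟨hxM, b, hb, hby.tail ⟨mem_nbrs_comm.1 hxy, hyM, hxM⟩⟩)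

theorem cluster_union {B M R : Finset Site} (hB : B ⊆ M)
    (hR : ∀ x ∈ R, ∀ y ∈ nbrs x, y ∉ cluster B M) :
    cluster B (R ∪ cluster B M) = cluster B M := by
  have hBc : B ⊆ cluster B M := fun b hb =>
    mem_cluster.2 ⟨hB hb, b, hb, Relation.ReflTransGen.refl⟩
  ext y
  constructor
  · intro hy
    obtain ⟨-, b, hb, hby⟩ := mem_cluster.1 hy
    induction hby with
    | refl => exact hBc hb
    | @tail u v h1 h2 ih =>
      have hu := ih (mem_cluster.2 ⟨h2.2.1, b, hb, h1⟩)
      rcases Finset.mem_union.1 h2.2.2 with hv | hv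
      · exact absurd hu (hR v hv u (mem_nbrs_comm.1 h2.1))
      · exact hv
  · intro hy
    obtain ⟨-, b, hb, hby⟩ := mem_cluster.1 hy
    refine mem_cluster.2 ⟨Finset.mem_union_right _ hy, b, hb, hby.restrict.mono fun z hz => ?_⟩
    exact Finset.mem_union_right _ (mem_cluster.2 ⟨hz.mem (hB hb), b, hb, hz⟩)

open Classical in
/-- Adding minus spins `A' \ A` to the conditioning affects an increasing local function only
through clusters joining `A' \ A` to its support. -/
theorem sensitivity {t : ℝ} (ht : 0 ≤ t) (ht1 : t ≤ 1) {g : Finset Site → ℝ} (hg : Monotone g)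
    (hg0 : ∀ M, 0 ≤ g M) (hg1 : ∀ M, g M ≤ 1) {T : Finset Site}
    (hgT : ∀ M c, Disjoint c T → g (M ∪ c) = g M) {Λ S A A' : Finset Site} :
    (∑ M ∈ fam Λ S A', wt t M * g M) * ∑ M ∈ fam Λ S A, wt t M ≤
      (∑ M ∈ fam Λ S A', wt t M) * (∑ M ∈ fam Λ S A, wt t M * g M) +
      (∑ M ∈ (fam Λ S A').filter (fun M => ¬ Disjoint (cluster (A' \ A) M) T), wt t M) *
        ∑ M ∈ fam Λ S A, wt t M := by
  have hw := wt_nonneg ht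
  have hZ : 0 ≤ ∑ M ∈ fam Λ S A, wt t M := Finset.sum_nonneg fun M _ => hw M
  have hZg : 0 ≤ ∑ M ∈ fam Λ S A, wt t M * g M :=
    Finset.sum_nonneg fun M _ => mul_nonneg (hw M) (hg0 M)
  set good := (fam Λ S A').filter (fun M => Disjoint (cluster (A' \ A) M) T) with hgood
  have key : (∑ M ∈ good, wt t M * g M) * ∑ M ∈ fam Λ S A, wt t M ≤
      (∑ M ∈ good, wt t M) * ∑ M ∈ fam Λ S A, wt t M * g M := by
    rw [← Finset.sum_fiberwise_of_maps_to (s := good) (t := good.image (cluster (A' \ A)))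
        (fun M hM => Finset.mem_image_of_mem _ hM) (fun M => wt t M * g M),
      ← Finset.sum_fiberwise_of_maps_to (s := good) (t := good.image (cluster (A' \ A)))
        (fun M hM => Finset.mem_image_of_mem _ hM) (wt t), Finset.sum_mul, Finset.sum_mul]
    refine Finset.sum_le_sum fun c hc => ?_
    obtain ⟨M₀, hM₀, rfl⟩ := Finset.mem_image.1 hc
    obtain ⟨hM₀f, hM₀T⟩ := Finset.mem_filter.1 hM₀
    obtain ⟨hM₀Λ, hM₀S⟩ := mem_fam.1 hM₀f
    have hAS : A' ⊆ S := hM₀S ▸ Finset.inter_subset_right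
    have hBof : ∀ {M}, M ∩ S = A' → A' \ A ⊆ M := fun {M} hM b hb =>
      (Finset.mem_inter.1 (hM ▸ (Finset.mem_sdiff.1 hb).1)).1
    have hB := hBof hM₀S
    set c := cluster (A' \ A) M₀ with hcdef
    have hcM : c ⊆ M₀ := Finset.filter_subset _ _
    have hBc : A' \ A ⊆ c := fun b hb =>
      mem_cluster.2 ⟨hB hb, b, hb, Relation.ReflTransGen.refl⟩
    set F := Λ.powerset.filter fun R => R ∩ S = A' \ c ∧ Disjoint R c ∧
      ∀ x ∈ R, ∀ y ∈ nbrs x, y ∉ c with hF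
    have hsum : ∀ f : Finset Site → ℝ, ∑ M ∈ good.filter (fun M => cluster (A' \ A) M = c), f M =
        ∑ R ∈ F, f (R ∪ c) := by
      intro f
      have hmem : ∀ M ∈ good.filter (fun M => cluster (A' \ A) M = c),
          (M ⊆ Λ ∧ M ∩ S = A') ∧ cluster (A' \ A) M = c := fun M hM =>
        ⟨mem_fam.1 (Finset.mem_filter.1 (Finset.mem_filter.1 hM).1).1, (Finset.mem_filter.1 hM).2⟩
      refine Finset.sum_nbij' (fun M => M \ c) (fun R => R ∪ c) ?_ ?_ ?_ ?_ ?_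
      · intro M hM
        obtain ⟨⟨h1, h2⟩, h3⟩ := hmem M hM
        refine Finset.mem_filter.2 ⟨Finset.mem_powerset.2 (Finset.sdiff_subset.trans h1), ?_,
          Finset.sdiff_disjoint, ?_⟩
        · rw [← h2, Finset.sdiff_inter_right_comm]
        · rw [← h3]
          exact cluster_sdiff_separated _ _
      · intro R hR
        obtain ⟨h1, h2, h3, h4⟩ := Finset.mem_filter.1 hR
        have h5 : cluster (A' \ A) (R ∪ c) = c := cluster_union hB h4
        refine Finset.mem_filter.2 ⟨Finset.mem_filter.2 ⟨mem_fam.2 ⟨?_, ?_⟩, ?_⟩, h5⟩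
        · exact Finset.union_subset (Finset.mem_powerset.1 h1) (hcM.trans hM₀Λ)
        · rw [Finset.union_inter_distrib_right, h2]
          ext u
          have e1 : u ∈ A' ↔ u ∈ M₀ ∧ u ∈ S := by rw [← hM₀S, Finset.mem_inter]
          have e2 := @hcM u
          simp only [Finset.mem_union, Finset.mem_sdiff, Finset.mem_inter]
          tauto
        · rw [h5]; exact hM₀T
      · intro M hM
        obtain ⟨-, h3⟩ := hmem M hM
        exact Finset.sdiff_union_of_subset (h3 ▸ Finset.filter_subset _ _)
      · intro R hR
        obtain ⟨-, -, h3, -⟩ := Finset.mem_filter.1 hR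
        exact Finset.union_sdiff_cancel_right h3
      · intro M hM
        obtain ⟨-, h3⟩ := hmem M hM
        rw [Finset.sdiff_union_of_subset (h3 ▸ Finset.filter_subset _ _)]
    have hwc : ∀ R ∈ F, wt t (R ∪ c) = wt t c * wt t R := by
      intro R hR
      obtain ⟨-, -, h3, h4⟩ := Finset.mem_filter.1 hR
      rw [wt, wt, wt, card_cut_union_of_separated h3 h4, mul_add, pow_add, mul_comm]
    rw [hsum, hsum, Finset.sum_congr rfl hwc, ← Finset.mul_sum,
      Finset.sum_congr rfl fun R hR => by rw [hwc R hR, hgT R c hM₀T, mul_assoc],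
      ← Finset.mul_sum, mul_assoc, mul_assoc]
    refine mul_le_mul_of_nonneg_left (holley ht ht1 hg hg0 (Λ := Λ) ?_ ?_ ?_) (hw c)
    · exact fun R hR => Finset.mem_powerset.1 (Finset.mem_filter.1 hR).1
    · exact fun R hR => (mem_fam.1 hR).1
    · intro R hR M hM
      obtain ⟨h1, h2, h3, h4⟩ := Finset.mem_filter.1 hR
      obtain ⟨h5, h6⟩ := mem_fam.1 hM
      have h7 : A' \ c ⊆ A := by
        intro u hu
        by_contra hA
        obtain ⟨hu1, hu2⟩ := Finset.mem_sdiff.1 hu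
        exact hu2 (hBc (Finset.mem_sdiff.2 ⟨hu1, hA⟩))
      refine ⟨Finset.mem_filter.2 ⟨Finset.mem_powerset.2 ?_, ?_, ?_, ?_⟩, mem_fam.2 ⟨?_, ?_⟩⟩
      · exact Finset.inter_subset_right.trans h5
      · rw [Finset.inter_inter_distrib_right, h2, h6]
        exact Finset.inter_eq_left.2 h7
      · exact h3.mono_left Finset.inter_subset_left
      · exact fun x hx => h4 x (Finset.inter_subset_left hx)
      · exact Finset.union_subset (Finset.mem_powerset.1 h1) h5
      · rw [Finset.union_inter_distrib_right, h2, h6]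
        exact Finset.union_eq_right.2 h7
  rw [← Finset.sum_filter_add_sum_filter_not (fam Λ S A')
    (fun M => Disjoint (cluster (A' \ A) M) T) (fun M => wt t M * g M), add_mul]
  refine add_le_add (key.trans (mul_le_mul_of_nonneg_right ?_ hZg))
    (mul_le_mul_of_nonneg_right (Finset.sum_le_sum fun M _ => ?_) hZ)
  · exact Finset.sum_le_sum_of_subset_of_nonneg (Finset.filter_subset _ _) fun M _ _ => hw M
  · exact mul_le_of_le_one_right (hw M) (hg1 M)

/-! ### Conditional probabilities in finite volume -/

/-- Partition function with the minus spins on `S` prescribed to be `A`. -/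
noncomputable def partFn (t : ℝ) (Λ S A : Finset Site) : ℝ := ∑ M ∈ fam Λ S A, wt t M

theorem partFn_nonneg {t : ℝ} (ht : 0 ≤ t) (Λ S A : Finset Site) : 0 ≤ partFn t Λ S A :=
  Finset.sum_nonneg fun M _ => wt_nonneg ht M

theorem partFn_pos {t : ℝ} (ht : 0 < t) {Λ S A : Finset Site} (hA : A ⊆ S) (hS : S ⊆ Λ) :
    0 < partFn t Λ S A :=
  Finset.sum_pos (fun M _ => wt_pos ht M)
    ⟨A, mem_fam.2 ⟨hA.trans hS, Finset.inter_eq_left.2 hA⟩⟩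

/-- Conditional expectation of `g` given that the minus spins on `S` are `A`. -/
noncomputable def condE (t : ℝ) (Λ S A : Finset Site) (g : Finset Site → ℝ) : ℝ :=
  (∑ M ∈ fam Λ S A, wt t M * g M) / partFn t Λ S A

theorem condE_mono {t : ℝ} (ht : 0 < t) (ht1 : t ≤ 1) {g : Finset Site → ℝ} (hg : Monotone g)
    (hg0 : ∀ M, 0 ≤ g M) {Λ S A A' : Finset Site} (hS : S ⊆ Λ) (hA' : A' ⊆ S) (hA : A ⊆ A') :
    condE t Λ S A g ≤ condE t Λ S A' g := by
  have h1 := partFn_pos ht (hA.trans hA') hS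
  have h2 := partFn_pos ht hA' hS
  rw [condE, condE, div_le_div_iff₀ h1 h2]
  refine (holley ht.le ht1 hg hg0 (Λ := Λ) (fun M hM => (mem_fam.1 hM).1)
    (fun M hM => (mem_fam.1 hM).1) ?_).trans_eq (mul_comm _ _)
  intro R hR M hM
  obtain ⟨a1, a2⟩ := mem_fam.1 hR
  obtain ⟨b1, b2⟩ := mem_fam.1 hM
  refine ⟨mem_fam.2 ⟨Finset.inter_subset_right.trans b1, ?_⟩,
    mem_fam.2 ⟨Finset.union_subset a1 b1, ?_⟩⟩
  · rw [Finset.inter_inter_distrib_right, a2, b2, Finset.inter_eq_left.2 hA]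
  · rw [Finset.union_inter_distrib_right, a2, b2, Finset.union_eq_right.2 hA]

theorem sum_biUnion_le {ι α : Type*} [DecidableEq ι] [DecidableEq α] (s : Finset ι)
    (f : ι → Finset α) {w : α → ℝ} (hw : ∀ a, 0 ≤ w a) :
    ∑ a ∈ s.biUnion f, w a ≤ ∑ i ∈ s, ∑ a ∈ f i, w a := by
  induction s using Finset.induction_on with
  | empty => simp
  | insert i s hi ih =>
    rw [Finset.biUnion_insert, Finset.sum_insert hi]
    have := Finset.sum_union_inter (s₁ := f i) (s₂ := s.biUnion f) (f := w)
    have := Finset.sum_nonneg fun a (_ : a ∈ f i ∩ s.biUnion f) => hw a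
    linarith

open Classical in
theorem sum_hit_le {l L : ℕ} (hL : 32 * l < L) {S Λ : Finset Site}
    (hS : ∀ s ∈ S, s.2 = 0 ∧ s.1 % L < l)
    (hΛ : ∀ y ∉ Λ, ∃ v, y + v ∈ nbrs y ∧ ∀ n : ℕ, y + n • v ∉ Λ) {A B T : Finset Site}
    {d : ℕ} (hd : 64 * l ≤ d) (hdist : ∀ b ∈ B, ∀ x ∈ T, (d : ℤ) ≤ |b.1 - x.1|)
    {t : ℝ} (ht : 0 ≤ t) (ht2 : 13122 * t ≤ 1 / 2) :
    ∑ M ∈ (fam Λ S A).filter (fun M => ¬ Disjoint (cluster B M) T), wt t M ≤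
      T.card * (2 * (1 / 2) ^ d) * partFn t Λ S A := by
  calc _ ≤ ∑ M ∈ T.biUnion (fun x => (fam Λ S A).filter (fun M => x ∈ M ∧ ∃ y,
          Joined {z | z ∈ M} x y ∧ (d : ℤ) ≤ |y.1 - x.1|)), wt t M := by
        refine Finset.sum_le_sum_of_subset_of_nonneg ?_ fun M _ _ => wt_nonneg ht M
        intro M hM
        obtain ⟨hMf, hMT⟩ := Finset.mem_filter.1 hM
        obtain ⟨x, hxc, hxT⟩ := Finset.not_disjoint_iff.1 hMT
        obtain ⟨hxM, b, hb, hbx⟩ := mem_cluster.1 hxc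
        exact Finset.mem_biUnion.2 ⟨x, hxT, Finset.mem_filter.2
          ⟨hMf, hxM, b, hbx.symm, hdist b hb x hxT⟩⟩
    _ ≤ ∑ x ∈ T, ∑ M ∈ (fam Λ S A).filter (fun M => x ∈ M ∧ ∃ y,
          Joined {z | z ∈ M} x y ∧ (d : ℤ) ≤ |y.1 - x.1|), wt t M :=
        sum_biUnion_le _ _ fun M => wt_nonneg ht M
    _ ≤ ∑ x ∈ T, 2 * (1 / 2) ^ d * partFn t Λ S A :=
        Finset.sum_le_sum fun x _ => sum_long_cluster_le hL hS hΛ A x hd ht ht2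
    _ = _ := by rw [Finset.sum_const, nsmul_eq_mul]; ring

theorem condE_le_add {l L : ℕ} (hL : 32 * l < L) {S Λ : Finset Site} (hSΛ : S ⊆ Λ)
    (hS : ∀ s ∈ S, s.2 = 0 ∧ s.1 % L < l)
    (hΛ : ∀ y ∉ Λ, ∃ v, y + v ∈ nbrs y ∧ ∀ n : ℕ, y + n • v ∉ Λ) {A A' T : Finset Site}
    (hA : A ⊆ S) (hA' : A' ⊆ S)
    {d : ℕ} (hd : 64 * l ≤ d) (hdist : ∀ b ∈ A' \ A, ∀ x ∈ T, (d : ℤ) ≤ |b.1 - x.1|)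
    {t : ℝ} (ht : 0 < t) (ht2 : 13122 * t ≤ 1 / 2) {g : Finset Site → ℝ} (hg : Monotone g)
    (hg0 : ∀ M, 0 ≤ g M) (hg1 : ∀ M, g M ≤ 1) (hgT : ∀ M c, Disjoint c T → g (M ∪ c) = g M) :
    condE t Λ S A' g ≤ condE t Λ S A g + T.card * (2 * (1 / 2) ^ d) := by
  classical
  have h1 := partFn_pos ht hA hSΛ
  have h2 := partFn_pos ht hA' hSΛ
  have key := sensitivity ht.le (by linarith) hg hg0 hg1 hgT (Λ := Λ) (S := S) (A := A) (A' := A')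
  have hit := sum_hit_le hL hS hΛ (A := A') hd hdist ht.le ht2
  rw [condE, condE, div_add' _ _ _ h1.ne', div_le_div_iff₀ h2 h1]
  have := mul_le_mul_of_nonneg_right hit h1.le
  unfold partFn at *
  linarith

theorem abs_condE_cylinder_sub_le_of_subset {l L : ℕ} (hL : 32 * l < L) {S Λ : Finset Site}
    (hSΛ : S ⊆ Λ) (hS : ∀ s ∈ S, s.2 = 0 ∧ s.1 % L < l)
    (hΛ : ∀ y ∉ Λ, ∃ v, y + v ∈ nbrs y ∧ ∀ n : ℕ, y + n • v ∉ Λ) {A A' T B : Finset Site}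
    (hAA' : A ⊆ A') (hA' : A' ⊆ S) (hB : B ⊆ T)
    {d : ℕ} (hd : 64 * l ≤ d) (hdist : ∀ b ∈ A' \ A, ∀ x ∈ T, (d : ℤ) ≤ |b.1 - x.1|)
    {t : ℝ} (ht : 0 < t) (ht2 : 13122 * t ≤ 1 / 2) :
    |condE t Λ S A' (fun M => if M ∩ T = B then 1 else 0) -
      condE t Λ S A (fun M => if M ∩ T = B then 1 else 0)| ≤ T.card * (2 * (1 / 2) ^ d) := by
  set g₁ : Finset Site → ℝ := fun M => if B ⊆ M then 1 else 0 with hg₁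
  set g₂ : Finset Site → ℝ := fun M => if B ⊆ M ∧ M ∩ T ≠ B then 1 else 0 with hg₂
  have hsplit : ∀ X : Finset Site, condE t Λ S X (fun M => if M ∩ T = B then 1 else 0) =
      condE t Λ S X g₁ - condE t Λ S X g₂ := by
    intro X
    rw [condE, condE, condE, ← sub_div, ← Finset.sum_sub_distrib]
    congr 1
    refine Finset.sum_congr rfl fun M _ => ?_
    rw [← mul_sub, hg₁, hg₂]
    by_cases h : M ∩ T = B
    · have : B ⊆ M := h ▸ Finset.inter_subset_left
      simp [h, this]
    · by_cases h2 : B ⊆ M <;> simp [h, h2]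
  have m₁ : Monotone g₁ := by
    intro M N hMN
    simp only [hg₁]
    split_ifs with h1 h2
    · exact le_rfl
    · exact absurd (h1.trans hMN) h2
    · exact zero_le_one
    · exact le_rfl
  have m₂ : Monotone g₂ := by
    intro M N hMN
    simp only [hg₂]
    split_ifs with h1 h2
    · exact le_rfl
    swap
    · exact zero_le_one
    swap
    · exact le_rfl
    refine absurd ⟨h1.1.trans hMN, fun h => h1.2 ?_⟩ h2
    exact (h ▸ Finset.inter_subset_inter_right hMN).antisymm
      (Finset.subset_inter h1.1 hB)
  have hBc : ∀ M c : Finset Site, Disjoint c T → (B ⊆ M ∪ c ↔ B ⊆ M) := by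
    intro M c hc
    refine ⟨fun h b hb => (Finset.mem_union.1 (h hb)).resolve_right fun hbc => ?_,
      fun h => h.trans Finset.subset_union_left⟩
    exact Finset.disjoint_left.1 hc hbc (hB hb)
  have hTc : ∀ M c : Finset Site, Disjoint c T → (M ∪ c) ∩ T = M ∩ T := by
    intro M c hc
    rw [Finset.union_inter_distrib_right, Finset.disjoint_iff_inter_eq_empty.1 hc,
      Finset.union_empty]
  have ht1 : t ≤ 1 := by linarith
  have u₁ := condE_le_add hL hSΛ hS hΛ (hAA'.trans hA') hA' hd hdist ht ht2 m₁
    (fun M => by simp only [hg₁]; split_ifs <;> norm_num)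
    (fun M => by simp only [hg₁]; split_ifs <;> norm_num)
    (fun M c hc => by simp only [hg₁, hBc M c hc])
  have u₂ := condE_le_add hL hSΛ hS hΛ (hAA'.trans hA') hA' hd hdist ht ht2 m₂
    (fun M => by simp only [hg₂]; split_ifs <;> norm_num)
    (fun M => by simp only [hg₂]; split_ifs <;> norm_num)
    (fun M c hc => by simp only [hg₂, hBc M c hc, hTc M c hc])
  have v₁ := condE_mono ht ht1 m₁ (fun M => by simp only [hg₁]; split_ifs <;> norm_num) hSΛ hA' hAA'
  have v₂ := condE_mono ht ht1 m₂ (fun M => by simp only [hg₂]; split_ifs <;> norm_num) hSΛ hA' hAA'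
  rw [hsplit, hsplit, abs_le]
  constructor <;> linarith

theorem condE_cylinder {t : ℝ} {Λ S A T B : Finset Site} (hST : Disjoint S T) (hA : A ⊆ S)
    (hB : B ⊆ T) :
    condE t Λ S A (fun M => if M ∩ T = B then 1 else 0) =
      partFn t Λ (S ∪ T) (A ∪ B) / partFn t Λ S A := by
  rw [condE]
  congr 1
  simp only [mul_ite, mul_one, mul_zero]
  rw [← Finset.sum_filter, partFn]
  refine Finset.sum_congr ?_ fun _ _ => rfl
  ext M
  rw [Finset.mem_filter, mem_fam, mem_fam, and_assoc]
  refine and_congr_right fun _ => ⟨fun ⟨h1, h2⟩ => ?_, fun h => ⟨?_, ?_⟩⟩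
  · rw [Finset.inter_union_distrib_left, h1, h2]
  · have h1 : M ∩ S = (M ∩ (S ∪ T)) ∩ S := by
      rw [Finset.inter_assoc, Finset.inter_eq_right.2 (Finset.subset_union_left (s₁ := S))]
    rw [h1, h, Finset.union_inter_distrib_right, Finset.inter_eq_left.2 hA,
      Finset.disjoint_iff_inter_eq_empty.1 (hST.symm.mono_left hB), Finset.union_empty]
  · have h1 : M ∩ T = (M ∩ (S ∪ T)) ∩ T := by
      rw [Finset.inter_assoc, Finset.inter_eq_right.2 (Finset.subset_union_right (s₁ := S))]
    rw [h1, h, Finset.union_inter_distrib_right, Finset.inter_eq_left.2 hB,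
      Finset.disjoint_iff_inter_eq_empty.1 (hST.mono_left hA), Finset.empty_union]

/-- Conditional probabilities depend exponentially little on far-away conditioning. -/
theorem abs_partFn_ratio_sub_le {l L : ℕ} (hL : 32 * l < L) {S Λ : Finset Site}
    (hSΛ : S ⊆ Λ) (hS : ∀ s ∈ S, s.2 = 0 ∧ s.1 % L < l)
    (hΛ : ∀ y ∉ Λ, ∃ v, y + v ∈ nbrs y ∧ ∀ n : ℕ, y + n • v ∉ Λ) {A A' T B : Finset Site}
    (hST : Disjoint S T) (hA : A ⊆ S) (hA' : A' ⊆ S) (hB : B ⊆ T)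
    {d : ℕ} (hd : 64 * l ≤ d) (hdist : ∀ b ∈ symmDiff A A', ∀ x ∈ T, (d : ℤ) ≤ |b.1 - x.1|)
    {t : ℝ} (ht : 0 < t) (ht2 : 13122 * t ≤ 1 / 2) :
    |partFn t Λ (S ∪ T) (A ∪ B) / partFn t Λ S A -
      partFn t Λ (S ∪ T) (A' ∪ B) / partFn t Λ S A'| ≤ T.card * (4 * (1 / 2) ^ d) := by
  have h1 := abs_condE_cylinder_sub_le_of_subset hL hSΛ hS hΛ
    (A := A ∩ A') (A' := A) Finset.inter_subset_left hA hB hd (fun b hb => hdist b (by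
      simp only [Finset.mem_sdiff, Finset.mem_inter, Finset.mem_symmDiff] at *; tauto)) ht ht2
  have h2 := abs_condE_cylinder_sub_le_of_subset hL hSΛ hS hΛ
    (A := A ∩ A') (A' := A') Finset.inter_subset_right hA' hB hd (fun b hb => hdist b (by
      simp only [Finset.mem_sdiff, Finset.mem_inter, Finset.mem_symmDiff] at *; tauto)) ht ht2
  rw [← condE_cylinder hST hA hB, ← condE_cylinder hST hA' hB]
  rw [abs_le] at *
  constructor <;> linarith [h1.1, h1.2, h2.1, h2.2]

/-- Finite energy. -/
theorem partFn_le_finite_energy {t : ℝ} (ht : 0 < t) (ht1 : t ≤ 1) {Λ S A T B : Finset Site}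
    (hST : Disjoint S T) (hT : T ⊆ Λ) (hB : B ⊆ T) :
    (t ^ 16 / 2) ^ T.card * partFn t Λ S A ≤ partFn t Λ (S ∪ T) (A ∪ B) := by
  set φ : Finset Site → Finset Site := fun M => (M \ T) ∪ B with hφ
  have hφmem : ∀ M ∈ fam Λ S A, φ M ∈ fam Λ (S ∪ T) (A ∪ B) := by
    intro M hM
    obtain ⟨h1, h2⟩ := mem_fam.1 hM
    refine mem_fam.2 ⟨Finset.union_subset (Finset.sdiff_subset.trans h1) (hB.trans hT), ?_⟩
    rw [← h2]
    ext u
    have e1 := @hB u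
    have e2 : u ∈ S → u ∉ T := fun h => Finset.disjoint_left.1 hST h
    simp only [hφ, Finset.mem_inter, Finset.mem_union, Finset.mem_sdiff]
    tauto
  have hwt : ∀ M, (t ^ 16) ^ T.card * wt t M ≤ wt t (φ M) := by
    intro M
    rw [wt, wt, ← pow_mul, ← pow_add]
    refine pow_le_pow_of_le_one ht.le ht1 ?_
    have h1 : φ M = symmDiff M (symmDiff M (φ M)) := (symmDiff_symmDiff_cancel_left _ _).symm
    have h2 := card_cut_symmDiff_le M (symmDiff M (φ M))
    have h3 := card_cut_le (symmDiff M (φ M))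
    have h4 : (symmDiff M (φ M)).card ≤ T.card := by
      refine Finset.card_le_card fun u hu => ?_
      have e1 := @hB u
      simp only [hφ, Finset.mem_symmDiff, Finset.mem_union, Finset.mem_sdiff] at hu
      tauto
    rw [← h1] at h2
    omega
  have hsum : (t ^ 16) ^ T.card * partFn t Λ S A ≤ 2 ^ T.card * partFn t Λ (S ∪ T) (A ∪ B) := by
    calc (t ^ 16) ^ T.card * partFn t Λ S A ≤ ∑ M ∈ fam Λ S A, wt t (φ M) := by
          rw [partFn, Finset.mul_sum]
          exact Finset.sum_le_sum fun M _ => hwt M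
      _ = ∑ N ∈ fam Λ (S ∪ T) (A ∪ B), ∑ M ∈ (fam Λ S A).filter (fun M => φ M = N),
            wt t (φ M) := (Finset.sum_fiberwise_of_maps_to hφmem _).symm
      _ ≤ ∑ N ∈ fam Λ (S ∪ T) (A ∪ B), 2 ^ T.card * wt t N := by
          refine Finset.sum_le_sum fun N _ => ?_
          rw [Finset.sum_congr rfl fun M hM => by rw [(Finset.mem_filter.1 hM).2],
            Finset.sum_const, nsmul_eq_mul]
          refine mul_le_mul_of_nonneg_right ?_ (wt_nonneg ht.le N)
          have : ((fam Λ S A).filter (fun M => φ M = N)).card ≤ T.powerset.card := by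
            refine Finset.card_le_card_of_injOn (fun M => M ∩ T) (fun M _ => ?_) ?_
            · exact Finset.mem_coe.2 (Finset.mem_powerset.2 Finset.inter_subset_right)
            · intro M hM M' hM' h
              have e := (Finset.mem_filter.1 (Finset.mem_coe.1 hM)).2.trans
                (Finset.mem_filter.1 (Finset.mem_coe.1 hM')).2.symm
              ext u
              have e1 := Finset.ext_iff.1 e u
              have e2 := Finset.ext_iff.1 h u
              have e3 := @hB u
              simp only [hφ, Finset.mem_inter, Finset.mem_union, Finset.mem_sdiff] at e1 e2
              tauto
          rw [Finset.card_powerset] at this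
          exact_mod_cast this
      _ = _ := by rw [partFn, Finset.mul_sum]
  rw [div_pow, div_mul_eq_mul_div, div_le_iff₀ (by positivity)]
  linarith

/-! ### The finite-volume measures in terms of sets of minus spins -/

/-- The configuration with set of minus spins `M`. -/
def cfg (M : Finset Site) : Cfg2 := fun x => decide (x ∉ M)

theorem sum_fill {E : Type*} [AddCommMonoid E] (Λ : Finset Site) (F : Cfg2 → E) :
    ∑ τ : ↥Λ → Bool, F (fill Λ (fun _ => true) τ) = ∑ M ∈ Λ.powerset, F (cfg M) := by
  have h1 : ∀ τ : ↥Λ → Bool, fill Λ (fun _ => true) τ =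
      cfg (Λ.filter fun x => fill Λ (fun _ => true) τ x = false) := by
    intro τ
    funext x
    by_cases hx : x ∈ Λ <;> simp [cfg, fill, hx]
  refine Finset.sum_nbij' (fun τ => Λ.filter fun x => fill Λ (fun _ => true) τ x = false)
    (fun M x => cfg M x) ?_ ?_ ?_ ?_ ?_
  · exact fun τ _ => Finset.mem_powerset.2 (Finset.filter_subset _ _)
  · exact fun _ _ => Finset.mem_univ _
  · intro τ _
    funext x
    rw [← h1]
    simp [fill]
  · intro M hM
    ext x
    have hsub : x ∈ M → x ∈ Λ := fun h => Finset.mem_powerset.1 hM h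
    by_cases hx : x ∈ Λ <;> by_cases hxM : x ∈ M <;> simp_all [fill, cfg]
  · intro τ _
    rw [← h1]

theorem sum_touching (Λ : Finset Site) (F : Site → Site → ℝ) (hF : ∀ x y, F x y = F y x) :
    ∑ e ∈ touching Λ, F e.1 e.2 = ∑ x ∈ Λ, ∑ y ∈ Λ.filter (fun y => y ∈ nbrs x), F x y +
      2 * ∑ x ∈ Λ, ∑ y ∈ (nbrs x).filter (fun y => y ∉ Λ), F x y := by
  rw [← Finset.sum_filter_add_sum_filter_not (touching Λ) (fun e => e.1 ∈ Λ),
    ← Finset.sum_filter_add_sum_filter_not ((touching Λ).filter fun e => e.1 ∈ Λ)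
      (fun e => e.2 ∈ Λ)]
  have hin : ∑ e ∈ ((touching Λ).filter fun e => e.1 ∈ Λ).filter (fun e => e.2 ∈ Λ), F e.1 e.2 =
      ∑ x ∈ Λ, ∑ y ∈ Λ.filter (fun y => y ∈ nbrs x), F x y := by
    rw [Finset.sum_sigma']
    refine Finset.sum_nbij' (fun e => ⟨e.1, e.2⟩) (fun e => (e.1, e.2)) ?_ ?_ ?_ ?_ ?_ <;>
      simp +contextual [mem_touching]
  have hout : ∑ e ∈ ((touching Λ).filter fun e => e.1 ∈ Λ).filter (fun e => e.2 ∉ Λ), F e.1 e.2 =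
      ∑ x ∈ Λ, ∑ y ∈ (nbrs x).filter (fun y => y ∉ Λ), F x y := by
    rw [Finset.sum_sigma']
    refine Finset.sum_nbij' (fun e => ⟨e.1, e.2⟩) (fun e => (e.1, e.2)) ?_ ?_ ?_ ?_ ?_ <;>
      simp +contextual [mem_touching]
  have hout2 : ∑ e ∈ (touching Λ).filter (fun e => e.1 ∉ Λ), F e.1 e.2 =
      ∑ x ∈ Λ, ∑ y ∈ (nbrs x).filter (fun y => y ∉ Λ), F x y := by
    rw [Finset.sum_sigma']
    refine Finset.sum_nbij' (fun e => ⟨e.2, e.1⟩) (fun e => (e.2, e.1)) ?_ ?_ ?_ ?_ ?_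
    · rintro ⟨x, y⟩ h
      simp only [Finset.mem_filter, mem_touching, Finset.mem_sigma] at h ⊢
      exact ⟨h.1.2.resolve_left h.2, mem_nbrs_comm.1 h.1.1, h.2⟩
    · rintro ⟨x, y⟩ h
      simp only [Finset.mem_filter, mem_touching, Finset.mem_sigma] at h ⊢
      exact ⟨⟨mem_nbrs_comm.1 h.2.1, Or.inr h.1⟩, h.2.2⟩
    · simp
    · simp
    · exact fun e _ => hF _ _
  rw [hin, hout, hout2]
  ring

theorem isingWeight_cfg (β : ℝ) {Λ M : Finset Site} (hM : M ⊆ Λ) :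
    isingWeight β 0 Λ (fun _ => true) (cfg M) =
      Real.exp (β * ((touching Λ).card / 2)) * wt (Real.exp (-β / 2)) M := by
  have hσ : ∑ x ∈ Λ, ∑ y ∈ (nbrs x).filter (fun y => y ∉ Λ), sval (cfg M x) * sval true =
      ∑ x ∈ Λ, ∑ y ∈ (nbrs x).filter (fun y => y ∉ Λ), sval (cfg M x) * sval (cfg M y) := by
    refine Finset.sum_congr rfl fun x _ => Finset.sum_congr rfl fun y hy => ?_
    have : y ∉ M := fun h => (Finset.mem_filter.1 hy).2 (hM h)
    simp [cfg, this]
  have hs := sum_touching Λ (fun x y => sval (cfg M x) * sval (cfg M y)) fun _ _ => mul_comm _ _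
  have hc : ∑ e ∈ touching Λ, sval (cfg M e.1) * sval (cfg M e.2) =
      (touching Λ).card - 2 * ((cut M).card : ℝ) := by
    rw [card_cut_eq_sum hM, Finset.cast_card, Nat.cast_sum, Finset.mul_sum,
      ← Finset.sum_sub_distrib]
    refine Finset.sum_congr rfl fun e _ => ?_
    by_cases h1 : e.1 ∈ M <;> by_cases h2 : e.2 ∈ M <;> simp [cfg, sval, h1, h2] <;> norm_num
  rw [isingWeight, hσ, wt, ← Real.exp_nat_mul, ← Real.exp_add]
  congr 1
  push_cast
  linear_combination (β / 2) * (hc - hs)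

/-- The weight of the configurations in `E`, relative to the partition function. -/
theorem isingFV_apply (β : ℝ) (Λ : Finset Site) {E : Set Cfg2} (hE : MeasurableSet E)
    [DecidablePred fun M => cfg M ∈ E] :
    isingFV β 0 Λ (fun _ => true) E = ENNReal.ofReal
      ((∑ M ∈ Λ.powerset.filter (fun M => cfg M ∈ E), wt (Real.exp (-β / 2)) M) /
        ∑ M ∈ Λ.powerset, wt (Real.exp (-β / 2)) M) := by
  set t := Real.exp (-β / 2) with ht
  have htpos : 0 < t := Real.exp_pos _
  set K := Real.exp (β * ((touching Λ).card / 2)) with hK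
  have hKpos : 0 < K := Real.exp_pos _
  have hZ : 0 < ∑ M ∈ Λ.powerset, wt t M :=
    Finset.sum_pos (fun M _ => wt_pos htpos M) ⟨∅, Finset.empty_mem_powerset _⟩
  have hden : ∑ τ : ↥Λ → Bool, ENNReal.ofReal
      (isingWeight β 0 Λ (fun _ => true) (fill Λ (fun _ => true) τ)) =
      ENNReal.ofReal (K * ∑ M ∈ Λ.powerset, wt t M) := by
    rw [sum_fill Λ (fun ω => ENNReal.ofReal (isingWeight β 0 Λ (fun _ => true) ω)),
      Finset.mul_sum, ENNReal.ofReal_sum_of_nonneg fun M _ => (mul_pos hKpos (wt_pos htpos M)).le]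
    exact Finset.sum_congr rfl fun M hM => by
      rw [isingWeight_cfg β (Finset.mem_powerset.1 hM)]
  have hnum : (∑ τ : ↥Λ → Bool, ENNReal.ofReal
      (isingWeight β 0 Λ (fun _ => true) (fill Λ (fun _ => true) τ)) •
        Measure.dirac (fill Λ (fun _ => true) τ)) E =
      ENNReal.ofReal (K * ∑ M ∈ Λ.powerset.filter (fun M => cfg M ∈ E), wt t M) := by
    rw [sum_fill Λ (fun ω => ENNReal.ofReal (isingWeight β 0 Λ (fun _ => true) ω) •
        Measure.dirac ω), Measure.finsetSum_apply, Finset.mul_sum,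
      ENNReal.ofReal_sum_of_nonneg fun M _ => (mul_pos hKpos (wt_pos htpos M)).le,
      Finset.sum_filter]
    refine Finset.sum_congr rfl fun M hM => ?_
    rw [isingWeight_cfg β (Finset.mem_powerset.1 hM), Measure.smul_apply,
      Measure.dirac_apply' _ hE, smul_eq_mul]
    by_cases h : cfg M ∈ E <;> simp [h, hK, ht]
  rw [isingFV, Measure.smul_apply, hden, hnum, smul_eq_mul, mul_comm, ← div_eq_mul_inv,
    ← ENNReal.ofReal_div_of_pos (mul_pos hKpos hZ), mul_div_mul_left _ _ hKpos.ne']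

/-- The event that the minus spins in `S` are those in `A`. -/
def cyl (S A : Finset Site) : Set Cfg2 := {η | ∀ i ∈ S, η i = cfg A i}

theorem measurableSet_cyl (S A : Finset Site) : MeasurableSet (cyl S A) := by
  have : cyl S A = ⋂ i ∈ S, (fun η : Cfg2 => η i) ⁻¹' {cfg A i} := by
    ext η; simp [cyl]
  rw [this]
  exact Finset.measurableSet_biInter S fun i _ => measurable_pi_apply i (measurableSet_singleton _)

theorem isingFV_cyl (β : ℝ) {Λ S A : Finset Site} (hA : A ⊆ S) :
    isingFV β 0 Λ (fun _ => true) (cyl S A) = ENNReal.ofReal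
      (partFn (Real.exp (-β / 2)) Λ S A / partFn (Real.exp (-β / 2)) Λ ∅ ∅) := by
  classical
  rw [isingFV_apply β Λ (measurableSet_cyl S A), partFn, partFn]
  congr 3
  · ext M
    simp only [Finset.mem_filter, Finset.mem_powerset, mem_fam]
    refine and_congr_right fun _ => ?_
    simp only [cyl, cfg, Set.mem_ofPred_eq, decide_eq_decide, not_iff_not]
    constructor
    · intro h
      ext x
      have := @hA x
      have := h x
      simp only [Finset.mem_inter]
      tauto
    · rintro rfl i hi
      simp [hi]
  · ext M
    simp [mem_fam]

theorem box_boundary_ray (n : ℕ) :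
    ∀ y ∉ box n, ∃ v, y + v ∈ nbrs y ∧ ∀ k : ℕ, y + k • v ∉ box n := by
  rintro ⟨a, b⟩ hy
  simp only [box, Finset.mem_product, Finset.mem_Icc] at hy
  by_cases h1 : (n : ℤ) < a
  · refine ⟨(1, 0), by simp [mem_nbrs], fun k => ?_⟩
    simp [box]; omega
  by_cases h2 : a < -(n : ℤ)
  · refine ⟨(-1, 0), by simp [mem_nbrs]; omega, fun k => ?_⟩
    simp [box]; omega
  by_cases h3 : (n : ℤ) < b
  · refine ⟨(0, 1), by simp [mem_nbrs], fun k => ?_⟩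
    simp [box]; omega
  · refine ⟨(0, -1), by simp [mem_nbrs]; omega, fun k => ?_⟩
    simp [box]; omega

theorem eventually_subset_box (S : Finset Site) : ∀ᶠ n in atTop, S ⊆ box n := by
  refine eventually_atTop.2 ⟨∑ x ∈ S, (x.1.natAbs + x.2.natAbs), fun n hn x hx => ?_⟩
  have := Finset.single_le_sum (f := fun x : Site => x.1.natAbs + x.2.natAbs)
    (fun _ _ => Nat.zero_le _) hx
  simp only [box, Finset.mem_product, Finset.mem_Icc]
  omega

/-! ### The plus phase -/

section Phase

variable {β : ℝ} {μ : Measure Cfg2}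

theorem tendsto_partFn (h : IsPlusPhase β 0 μ) {S A : Finset Site} (hA : A ⊆ S) :
    Tendsto (fun n => partFn (Real.exp (-β / 2)) (box n) S A /
      partFn (Real.exp (-β / 2)) (box n) ∅ ∅) atTop (𝓝 (μ.real (cyl S A))) := by
  have := h.1
  have h1 := (ENNReal.tendsto_toReal (measure_ne_top μ (cyl S A))).comp (h.2 S (cfg A))
  refine h1.congr fun n => ?_
  change (isingFV β 0 (box n) (fun _ => true) (cyl S A)).toReal = _
  rw [isingFV_cyl β hA, ENNReal.toReal_ofReal]
  exact div_nonneg (partFn_nonneg (Real.exp_pos _).le _ _ _)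
    (partFn_nonneg (Real.exp_pos _).le _ _ _)

theorem phase_finite_energy (h : IsPlusPhase β 0 μ) (ht1 : Real.exp (-β / 2) ≤ 1)
    {S A T B : Finset Site} (hST : Disjoint S T) (hA : A ⊆ S) (hB : B ⊆ T) :
    (Real.exp (-β / 2) ^ 16 / 2) ^ T.card * μ.real (cyl S A) ≤ μ.real (cyl (S ∪ T) (A ∪ B)) := by
  refine le_of_tendsto_of_tendsto ((tendsto_partFn h hA).const_mul _)
    (tendsto_partFn h (Finset.union_subset_union hA hB)) ?_
  filter_upwards [eventually_subset_box T] with n hn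
  rw [mul_div_assoc']
  exact div_le_div_of_nonneg_right (partFn_le_finite_energy (Real.exp_pos _) ht1 hST hn hB)
    (partFn_nonneg (Real.exp_pos _).le _ _ _)

theorem phase_cyl_pos (h : IsPlusPhase β 0 μ) (ht1 : Real.exp (-β / 2) ≤ 1)
    {S A : Finset Site} (hA : A ⊆ S) : 0 < μ.real (cyl S A) := by
  have := h.1
  have h1 := phase_finite_energy h ht1 (Finset.disjoint_empty_left S) subset_rfl hA
  have h2 : cyl ∅ ∅ = Set.univ := by ext; simp [cyl]
  rw [h2, probReal_univ, Finset.empty_union, Finset.empty_union] at h1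
  exact lt_of_lt_of_le (by positivity) h1

theorem phase_ratio_sub_le (h : IsPlusPhase β 0 μ) (ht2 : 13122 * Real.exp (-β / 2) ≤ 1 / 2)
    {l L : ℕ} (hL : 32 * l < L) {S A A' T B : Finset Site}
    (hS : ∀ s ∈ S, s.2 = 0 ∧ s.1 % L < l)
    (hST : Disjoint S T) (hA : A ⊆ S) (hA' : A' ⊆ S) (hB : B ⊆ T)
    {d : ℕ} (hd : 64 * l ≤ d) (hdist : ∀ b ∈ symmDiff A A', ∀ x ∈ T, (d : ℤ) ≤ |b.1 - x.1|) :
    |μ.real (cyl (S ∪ T) (A ∪ B)) / μ.real (cyl S A) -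
      μ.real (cyl (S ∪ T) (A' ∪ B)) / μ.real (cyl S A')| ≤ T.card * (4 * (1 / 2) ^ d) := by
  have htpos := Real.exp_pos (-β / 2)
  have ht1 : Real.exp (-β / 2) ≤ 1 := by linarith
  have key : ∀ A ⊆ S, Tendsto (fun n => partFn (Real.exp (-β / 2)) (box n) (S ∪ T) (A ∪ B) /
      partFn (Real.exp (-β / 2)) (box n) S A) atTop
      (𝓝 (μ.real (cyl (S ∪ T) (A ∪ B)) / μ.real (cyl S A))) := by
    intro A hA
    refine ((tendsto_partFn h (Finset.union_subset_union hA hB)).div (tendsto_partFn h hA)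
      (phase_cyl_pos h ht1 hA).ne').congr fun n => ?_
    have : 0 < partFn (Real.exp (-β / 2)) (box n) ∅ ∅ :=
      partFn_pos htpos subset_rfl (Finset.empty_subset _)
    exact div_div_div_cancel_right₀ this.ne' _ _
  refine le_of_tendsto ((key A hA).sub (key A' hA')).abs ?_
  filter_upwards [eventually_subset_box S] with n hn
  exact abs_partFn_ratio_sub_le hL hn hS (box_boundary_ray n) hST hA hA' hB hd hdist htpos ht2

/-! ### Translation invariance -/

theorem card_cut_map_add (v : Site) (M : Finset Site) :
    (cut (M.map (addRightEmbedding v))).card = (cut M).card := by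
  refine (Finset.card_nbij' (fun e => (e.1 + v, e.2 + v)) (fun e => (e.1 - v, e.2 - v))
    ?_ ?_ ?_ ?_).symm
  · rintro ⟨⟨a, b⟩, ⟨c, d⟩⟩ he
    simp only [Finset.mem_coe, mem_cut, mem_nbrs, Finset.mem_map, addRightEmbedding_apply,
      add_left_inj, exists_eq_right] at he ⊢
    refine ⟨?_, he.2⟩
    simp only [Prod.ext_iff, Prod.fst_add, Prod.snd_add] at he ⊢
    omega
  · rintro ⟨⟨a, b⟩, ⟨c, d⟩⟩ he
    simp only [Finset.mem_coe, mem_cut, mem_nbrs, Finset.mem_map, addRightEmbedding_apply,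
      ← eq_sub_iff_add_eq, exists_eq_right] at he ⊢
    refine ⟨?_, he.2⟩
    simp only [Prod.ext_iff, Prod.fst_sub, Prod.snd_sub] at he ⊢
    omega
  · intro e _; simp
  · intro e _; simp

theorem partFn_map_add (t : ℝ) (v : Site) (Λ S A : Finset Site) :
    partFn t (Λ.map (addRightEmbedding v)) (S.map (addRightEmbedding v))
      (A.map (addRightEmbedding v)) = partFn t Λ S A := by
  have : fam (Λ.map (addRightEmbedding v)) (S.map (addRightEmbedding v))
      (A.map (addRightEmbedding v)) = (fam Λ S A).image (Finset.map (addRightEmbedding v)) := by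
    ext M
    rw [mem_fam, Finset.mem_image]
    constructor
    · rintro ⟨h1, h2⟩
      obtain ⟨N, hN, rfl⟩ := Finset.subset_map_iff.1 h1
      rw [← Finset.map_inter] at h2
      exact ⟨N, mem_fam.2 ⟨hN, Finset.map_injective _ h2⟩, rfl⟩
    · rintro ⟨N, hN, rfl⟩
      obtain ⟨h1, h2⟩ := mem_fam.1 hN
      rw [← Finset.map_inter, h2]
      exact ⟨Finset.map_subset_map.2 h1, rfl⟩
  rw [partFn, this, Finset.sum_image fun _ _ _ _ h => Finset.map_injective _ h]
  exact Finset.sum_congr rfl fun M _ => by rw [wt, wt, card_cut_map_add]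

/-- The probability of all plus on `S` decreases with the volume. -/
theorem partFn_ratio_antitone {t : ℝ} (ht : 0 < t) (ht1 : t ≤ 1) {Λ Λ' : Finset Site}
    (hΛ : Λ ⊆ Λ') (S : Finset Site) :
    partFn t Λ' S ∅ / partFn t Λ' ∅ ∅ ≤ partFn t Λ S ∅ / partFn t Λ ∅ ∅ := by
  have h1 : 0 < partFn t Λ ∅ ∅ := partFn_pos ht subset_rfl (Finset.empty_subset _)
  have h2 : 0 < partFn t Λ' ∅ ∅ := partFn_pos ht subset_rfl (Finset.empty_subset _)
  set g : Finset Site → ℝ := fun M => if M ∩ S = ∅ then 0 else 1 with hg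
  have hgm : Monotone g := by
    intro M N hMN
    simp only [hg]
    split_ifs with a b
    · exact le_rfl
    · exact zero_le_one
    · exact absurd (Finset.subset_empty.1 (‹N ∩ S = ∅› ▸ Finset.inter_subset_inter_right hMN)) a
    · exact le_rfl
  have hsum : ∀ Λ, ∑ M ∈ fam Λ ∅ ∅, wt t M * g M = partFn t Λ ∅ ∅ - partFn t Λ S ∅ := by
    intro Λ
    have : fam Λ S ∅ = (fam Λ ∅ ∅).filter fun M => M ∩ S = ∅ := by
      ext M
      simp [mem_fam]
    rw [partFn, partFn, this, Finset.sum_filter, ← Finset.sum_sub_distrib]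
    refine Finset.sum_congr rfl fun M _ => ?_
    by_cases hM : M ∩ S = ∅ <;> simp [hg, hM]
  have key := holley ht.le ht1 hgm (fun M => by simp only [hg]; split_ifs <;> norm_num) (Λ := Λ')
    (F := fam Λ ∅ ∅) (G := fam Λ' ∅ ∅) (fun M hM => (mem_fam.1 hM).1.trans hΛ)
    (fun M hM => (mem_fam.1 hM).1) fun R hR M hM => ⟨mem_fam.2 ⟨Finset.inter_subset_left.trans
      (mem_fam.1 hR).1, Finset.inter_empty _⟩, mem_fam.2 ⟨Finset.union_subset
      ((mem_fam.1 hR).1.trans hΛ) (mem_fam.1 hM).1, Finset.inter_empty _⟩⟩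
  rw [hsum, hsum] at key
  rw [div_le_div_iff₀ h2 h1]
  unfold partFn at *
  linarith

theorem phase_cyl_map_ge (h : IsPlusPhase β 0 μ) (ht1 : Real.exp (-β / 2) ≤ 1) (v : Site)
    (S : Finset Site) :
    μ.real (cyl S ∅) ≤ μ.real (cyl (S.map (addRightEmbedding v)) ∅) := by
  set c := v.1.natAbs + v.2.natAbs
  refine le_of_tendsto_of_tendsto'
    ((tendsto_partFn h (Finset.empty_subset S)).comp (tendsto_add_atTop_nat c))
    (tendsto_partFn h (Finset.empty_subset _)) fun n => ?_
  have hbox : box n ⊆ (box (n + c)).map (addRightEmbedding v) := by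
    intro x hx
    rw [Finset.mem_map]
    refine ⟨x - v, ?_, by simp⟩
    simp only [box, Finset.mem_product, Finset.mem_Icc, Prod.fst_sub, Prod.snd_sub] at hx ⊢
    push_cast
    omega
  have := partFn_ratio_antitone (Real.exp_pos (-β / 2)) ht1 hbox (S.map (addRightEmbedding v))
  have e1 := partFn_map_add (Real.exp (-β / 2)) v (box (n + c)) S ∅
  have e2 := partFn_map_add (Real.exp (-β / 2)) v (box (n + c)) ∅ ∅
  rw [Finset.map_empty] at e1 e2
  rwa [e1, e2] at this

theorem generateFrom_cyl_empty :
    MeasurableSpace.generateFrom (Set.range fun S : Finset Site => cyl S ∅) =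
      (inferInstance : MeasurableSpace Cfg2) := by
  refine le_antisymm (MeasurableSpace.generateFrom_le ?_) (iSup_le fun i => ?_)
  · rintro _ ⟨S, rfl⟩
    exact measurableSet_cyl S ∅
  · rw [← measurable_iff_comap_le]
    refine @measurable_to_bool _ (MeasurableSpace.generateFrom _) _
      (MeasurableSpace.measurableSet_generateFrom ⟨{i}, ?_⟩)
    ext η
    simp [cyl, cfg]

theorem isPiSystem_cyl_empty : IsPiSystem (Set.range fun S : Finset Site => cyl S ∅) := by
  rintro _ ⟨S, rfl⟩ _ ⟨T, rfl⟩ -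
  refine ⟨S ∪ T, ?_⟩
  ext η
  simp only [cyl, Finset.mem_union, Set.mem_inter_iff, Set.mem_ofPred_eq]
  exact ⟨fun h => ⟨fun i hi => h i (Or.inl hi), fun i hi => h i (Or.inr hi)⟩,
    fun h i hi => hi.elim (h.1 i) (h.2 i)⟩

theorem phase_map_add (h : IsPlusPhase β 0 μ) (ht1 : Real.exp (-β / 2) ≤ 1) (v : Site) :
    μ.map (fun η x => η (x + v)) = μ := by
  have := h.1
  have hm : Measurable fun (η : Cfg2) (x : Site) => η (x + v) :=
    measurable_pi_lambda _ fun x => measurable_pi_apply _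
  have := Measure.isProbabilityMeasure_map (μ := μ) hm.aemeasurable
  refine ext_of_generate_finite _ generateFrom_cyl_empty.symm isPiSystem_cyl_empty ?_ (by simp)
  rintro _ ⟨S, rfl⟩
  have hpre : (fun (η : Cfg2) (x : Site) => η (x + v)) ⁻¹' cyl S ∅ =
      cyl (S.map (addRightEmbedding v)) ∅ := by
    ext η
    simp only [cyl, cfg, Set.mem_preimage, Set.mem_ofPred_eq, Finset.forall_mem_map,
      addRightEmbedding_apply, Finset.notMem_empty, not_false_eq_true]
  rw [Measure.map_apply hm (measurableSet_cyl _ _), hpre]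
  refine (measureReal_eq_measureReal_iff).1 (le_antisymm ?_ (phase_cyl_map_ge h ht1 v S))
  have h1 := phase_cyl_map_ge h ht1 (-v) (S.map (addRightEmbedding v))
  have h2 : (S.map (addRightEmbedding v)).map (addRightEmbedding (-v)) = S := by
    rw [Finset.map_map]
    refine Eq.trans ?_ (Finset.map_refl (s := S))
    congr 1
    ext x <;> simp
  rwa [h2] at h1

end Phase

/-! ### A criterion for regular g-measures -/

/-- Pasts agreeing with `ω` on the last `n` coordinates. -/
def pastCyl {A : Type*} (n : ℕ) (ω : Past A) : Set (Past A) := {u | ∀ j < n, u j = ω j}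

theorem isPiSystem_pastCyl {A : Type*} :
    IsPiSystem (Set.range fun q : ℕ × Past A => pastCyl q.1 q.2) := by
  rintro _ ⟨⟨n, ω⟩, rfl⟩ _ ⟨⟨m, σ⟩, rfl⟩ ⟨u, hu, hu'⟩
  refine ⟨(max n m, u), ?_⟩
  ext v
  simp only [pastCyl, Set.mem_ofPred_eq, Set.mem_inter_iff] at *
  constructor
  · exact fun h => ⟨fun j hj => (h j (lt_max_of_lt_left hj)).trans (hu j hj),
      fun j hj => (h j (lt_max_of_lt_right hj)).trans (hu' j hj)⟩
  · rintro ⟨h1, h2⟩ j hj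
    rcases lt_max_iff.1 hj with hj | hj
    · exact (h1 j hj).trans (hu j hj).symm
    · exact (h2 j hj).trans (hu' j hj).symm

section PastCyl

variable {A : Type*} [MeasurableSpace A]

theorem measurable_restrictPast : Measurable (restrictPast : ZSeq A → Past A) :=
  measurable_pi_lambda _ fun _ => measurable_pi_apply _

theorem pastSigma_le : pastSigma A ≤ (inferInstance : MeasurableSpace (ZSeq A)) :=
  measurable_iff_comap_le.1 measurable_restrictPast

theorem measurableSet_letter [MeasurableSingletonClass A] (a : A) :
    MeasurableSet {η : ZSeq A | η 0 = a} := by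
  have h : Measurable fun η : ZSeq A => η 0 := measurable_pi_apply 0
  exact h (measurableSet_singleton a)

theorem measurableSet_pastCyl [MeasurableSingletonClass A] (n : ℕ) (ω : Past A) :
    MeasurableSet (pastCyl n ω) := by
  have : pastCyl n ω = ⋂ j ∈ Finset.range n, (fun u : Past A => u j) ⁻¹' {ω j} := by
    ext u; simp [pastCyl]
  rw [this]
  exact Finset.measurableSet_biInter _ fun j _ => measurable_pi_apply j (measurableSet_singleton _)

theorem generateFrom_pastCyl [Finite A] [MeasurableSingletonClass A] :
    MeasurableSpace.generateFrom (Set.range fun q : ℕ × Past A => pastCyl q.1 q.2) =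
      (inferInstance : MeasurableSpace (Past A)) := by
  refine le_antisymm (MeasurableSpace.generateFrom_le ?_) (iSup_le fun j => ?_)
  · rintro _ ⟨q, rfl⟩
    exact measurableSet_pastCyl _ _
  · rw [← measurable_iff_comap_le]
    refine @measurable_to_countable' _ _ _ _ (MeasurableSpace.generateFrom _) _ fun b => ?_
    have : (fun u : Past A => u j) ⁻¹' {b} = ⋃ v : Fin j → A,
        pastCyl (j + 1) (fun i => if h : i < j then v ⟨i, h⟩ else b) := by
      ext u
      simp only [Set.mem_preimage, Set.mem_singleton_iff, Set.mem_iUnion, pastCyl,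
        Set.mem_ofPred_eq]
      constructor
      · rintro rfl
        refine ⟨fun i => u i, fun i hi => ?_⟩
        by_cases h : i < j
        · simp [h]
        · obtain rfl : i = j := by omega
          simp
      · rintro ⟨v, hv⟩
        simpa using hv j (Nat.lt_succ_self j)
    rw [this]
    exact MeasurableSet.iUnion fun v => MeasurableSpace.measurableSet_generateFrom ⟨(_, _), rfl⟩

theorem measureReal_eq_sum_update [Fintype A] [MeasurableSingletonClass A] (ν : Measure (ZSeq A))
    [IsFiniteMeasure ν] (n : ℕ) (ω : Past A) (E : Set (ZSeq A)) (hE : MeasurableSet E) :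
    ν.real (restrictPast ⁻¹' pastCyl n ω ∩ E) = ∑ b : A,
      ν.real (restrictPast ⁻¹' pastCyl (n + 1) (Function.update ω n b) ∩ E) := by
  have hset : ∀ b, restrictPast ⁻¹' pastCyl (n + 1) (Function.update ω n b) ∩ E =
      (fun η => restrictPast η n) ⁻¹' {b} ∩ (restrictPast ⁻¹' pastCyl n ω ∩ E) := by
    intro b
    ext η
    simp only [pastCyl, Set.mem_inter_iff, Set.mem_preimage, Set.mem_ofPred_eq,
      Set.mem_singleton_iff, ← and_assoc]
    refine and_congr_left fun _ => ⟨fun h => ⟨?_, fun j hj => ?_⟩, fun h j hj => ?_⟩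
    · simpa using h n (Nat.lt_succ_self n)
    · simpa [hj.ne] using h j (by omega)
    · by_cases hjn : j = n
      · subst hjn; simpa using h.1
      · simpa [hjn] using h.2 j (by omega)
  have hm : Measurable fun η : ZSeq A => restrictPast η n := measurable_pi_apply _
  have hS : MeasurableSet (restrictPast ⁻¹' pastCyl n ω ∩ E : Set (ZSeq A)) :=
    (measurable_restrictPast (measurableSet_pastCyl n ω)).inter hE
  have := sum_measureReal_preimage_singleton (μ := ν.restrict (restrictPast ⁻¹' pastCyl n ω ∩ E))
    Finset.univ (f := fun η : ZSeq A => restrictPast η n) fun b _ => hm (measurableSet_singleton b)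
  simp only [Finset.coe_univ, Set.preimage_univ] at this
  rw [measureReal_restrict_apply MeasurableSet.univ, Set.univ_inter] at this
  rw [← this]
  refine Finset.sum_congr rfl fun b _ => ?_
  rw [measureReal_restrict_apply (hm (measurableSet_singleton b)), hset]

end PastCyl

theorem continuous_of_forall_abs_sub_le {A : Type*} [TopologicalSpace A]
    [DiscreteTopology A] {f : Past A → ℝ} {C ρ : ℝ} (hρ0 : 0 ≤ ρ) (hρ : ρ < 1)
    (hf : ∀ m ω ω', (∀ j < m, ω j = ω' j) → |f ω - f ω'| ≤ C * ρ ^ m) : Continuous f := by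
  refine continuous_iff_continuousAt.2 fun ω => Metric.tendsto_nhds.2 fun ε hε => ?_
  have hlim : Tendsto (fun m => C * ρ ^ m) atTop (𝓝 (C * 0)) :=
    (tendsto_pow_atTop_nhds_zero_of_lt_one hρ0 hρ).const_mul _
  rw [mul_zero] at hlim
  obtain ⟨m, hm⟩ := (hlim.eventually (gt_mem_nhds hε)).exists
  have hev : ∀ᶠ u : Past A in 𝓝 ω, ∀ j ∈ Finset.range m, u j = ω j := by
    refine (Finset.eventually_all _).2 fun j _ => ?_
    exact (continuous_apply j).continuousAt.eventually
      (show ∀ᶠ x in 𝓝 (ω j), x = ω j by simp [nhds_discrete])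
  filter_upwards [hev] with u hu
  rw [Real.dist_eq]
  exact (hf m u ω fun j hj => hu j (Finset.mem_range.2 hj)).trans_lt hm

section Criterion

variable {A : Type*} [Fintype A] [MeasurableSpace A] [MeasurableSingletonClass A]

/-- Conditional probability of the letter `a` given the last `n` letters. -/
noncomputable def stepProb (ν : Measure (ZSeq A)) (n : ℕ) (a : A) (ω : Past A) : ℝ :=
  ν.real (restrictPast ⁻¹' pastCyl n ω ∩ {η | η 0 = a}) / ν.real (restrictPast ⁻¹' pastCyl n ω)

variable {ν : Measure (ZSeq A)} [IsProbabilityMeasure ν] {C ρ : ℝ}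

theorem abs_stepProb_succ_sub_le (hpos : ∀ n ω, 0 < ν.real (restrictPast ⁻¹' pastCyl n ω))
    (hclose : ∀ m n ω ω' a, m ≤ n → (∀ j < m, ω j = ω' j) →
      |stepProb ν n a ω - stepProb ν n a ω'| ≤ C * ρ ^ m) (n : ℕ) (a : A) (ω : Past A) :
    |stepProb ν n a ω - stepProb ν (n + 1) a ω| ≤ C * ρ ^ n := by
  have hE : MeasurableSet {η : ZSeq A | η 0 = a} := measurableSet_letter a
  have h1 := measureReal_eq_sum_update ν n ω _ hE
  have h2 := measureReal_eq_sum_update ν n ω _ MeasurableSet.univ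
  simp only [Set.inter_univ] at h2
  have hw : ∀ n ω, ν.real (restrictPast ⁻¹' pastCyl n ω ∩ {η | η 0 = a}) =
      stepProb ν n a ω * ν.real (restrictPast ⁻¹' pastCyl n ω) := fun n ω =>
    (div_mul_cancel₀ _ (hpos n ω).ne').symm
  simp only [hw] at h1
  have h3 : (stepProb ν n a ω - stepProb ν (n + 1) a ω) *
      ν.real (restrictPast ⁻¹' pastCyl n ω) = ∑ b : A,
        (stepProb ν (n + 1) a (Function.update ω n b) - stepProb ν (n + 1) a ω) *
          ν.real (restrictPast ⁻¹' pastCyl (n + 1) (Function.update ω n b)) := by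
    rw [sub_mul, h1, h2, Finset.mul_sum, ← Finset.sum_sub_distrib]
    exact Finset.sum_congr rfl fun b _ => (sub_mul _ _ _).symm
  refine le_of_mul_le_mul_right ?_ (hpos n ω)
  rw [← abs_of_pos (hpos n ω), ← abs_mul, h3, abs_of_pos (hpos n ω), h2, Finset.mul_sum]
  refine (Finset.abs_sum_le_sum_abs _ _).trans (Finset.sum_le_sum fun b _ => ?_)
  rw [abs_mul, abs_of_pos (hpos _ _)]
  refine mul_le_mul_of_nonneg_right (hclose _ _ _ _ _ (Nat.le_succ n) fun j hj => ?_) (hpos _ _).le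
  exact Function.update_of_ne hj.ne _ _

theorem sum_stepProb (hpos : ∀ n ω, 0 < ν.real (restrictPast ⁻¹' pastCyl n ω)) (n : ℕ)
    (ω : Past A) : ∑ a, stepProb ν n a ω = 1 := by
  have hm : Measurable fun η : ZSeq A => η 0 := measurable_pi_apply 0
  have := sum_measureReal_preimage_singleton (μ := ν.restrict (restrictPast ⁻¹' pastCyl n ω))
    Finset.univ (f := fun η : ZSeq A => η 0) fun b _ => hm (measurableSet_singleton b)
  simp only [Finset.coe_univ, Set.preimage_univ] at this
  rw [measureReal_restrict_apply MeasurableSet.univ, Set.univ_inter] at this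
  simp only [stepProb]
  rw [← Finset.sum_div, div_eq_one_iff_eq (hpos n ω).ne', ← this]
  refine Finset.sum_congr rfl fun a _ => ?_
  rw [measureReal_restrict_apply (hm (measurableSet_singleton a)), Set.inter_comm]
  rfl

theorem setIntegral_pastCyl_eq (hρ0 : 0 ≤ ρ) (hρ : ρ < 1)
    (hpos : ∀ n ω, 0 < ν.real (restrictPast ⁻¹' pastCyl n ω)) {a : A} {P : Past A → ℝ} {C' : ℝ}
    (hint : Integrable (fun η => P (restrictPast η)) ν)
    (hP : ∀ n ω, ∀ u ∈ pastCyl n ω, |P u - stepProb ν n a ω| ≤ C' * ρ ^ n) (n : ℕ) (ω : Past A) :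
    ∫ η in restrictPast ⁻¹' pastCyl n ω, P (restrictPast η) ∂ν =
      ν.real (restrictPast ⁻¹' pastCyl n ω ∩ {η | η 0 = a}) := by
  have hE : MeasurableSet {η : ZSeq A | η 0 = a} := measurableSet_letter a
  have hcyl : ∀ n ω, MeasurableSet (restrictPast ⁻¹' pastCyl n ω : Set (ZSeq A)) := fun n ω =>
    measurable_restrictPast (measurableSet_pastCyl n ω)
  have hbound : ∀ k n ω, |∫ η in restrictPast ⁻¹' pastCyl n ω, P (restrictPast η) ∂ν -
      ν.real (restrictPast ⁻¹' pastCyl n ω ∩ {η | η 0 = a})| ≤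
        C' * ρ ^ (n + k) * ν.real (restrictPast ⁻¹' pastCyl n ω) := by
    intro k
    induction k with
    | zero =>
      intro n ω
      have h1 : ν.real (restrictPast ⁻¹' pastCyl n ω ∩ {η | η 0 = a}) =
          ∫ η in restrictPast ⁻¹' pastCyl n ω, stepProb ν n a ω ∂ν := by
        rw [setIntegral_const, smul_eq_mul, mul_comm]
        exact (div_mul_cancel₀ _ (hpos n ω).ne').symm
      rw [h1, ← integral_sub hint.integrableOn (integrable_const _), add_zero]
      exact norm_setIntegral_le_of_norm_le_const (C := C' * ρ ^ n)
        (f := fun η => P (restrictPast η) - stepProb ν n a ω) (measure_lt_top _ _)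
        fun η hη => hP n ω _ hη
    | succ k ih =>
      intro n ω
      have h1 := measureReal_eq_sum_update ν n ω _ hE
      have h2 := measureReal_eq_sum_update ν n ω _ MeasurableSet.univ
      simp only [Set.inter_univ] at h2
      have hset : (restrictPast ⁻¹' pastCyl n ω : Set (ZSeq A)) = ⋃ b ∈ (Finset.univ : Finset A),
          restrictPast ⁻¹' pastCyl (n + 1) (Function.update ω n b) := by
        ext η
        simp only [pastCyl, Set.mem_preimage, Set.mem_ofPred_eq, Set.mem_iUnion, Finset.mem_univ,
          exists_prop, true_and]
        constructor
        · refine fun h => ⟨restrictPast η n, fun j hj => ?_⟩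
          by_cases hjn : j = n
          · subst hjn; simp
          · simpa [hjn] using h j (by omega)
        · rintro ⟨b, h⟩ j hj
          simpa [hj.ne] using h j (by omega)
      have hdisj : Set.PairwiseDisjoint (↑(Finset.univ : Finset A)) fun b : A =>
          (restrictPast ⁻¹' pastCyl (n + 1) (Function.update ω n b) : Set (ZSeq A)) := by
        intro b _ c _ hbc
        refine Set.disjoint_left.2 fun η hb hc => hbc ?_
        have e1 := hb n (Nat.lt_succ_self n)
        have e2 := hc n (Nat.lt_succ_self n)
        simp only [Function.update_self] at e1 e2
        exact e1.symm.trans e2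
      have h3 : ∫ η in restrictPast ⁻¹' pastCyl n ω, P (restrictPast η) ∂ν = ∑ b : A,
          ∫ η in restrictPast ⁻¹' pastCyl (n + 1) (Function.update ω n b),
            P (restrictPast η) ∂ν := by
        rw [hset]
        exact integral_biUnion_finset _ (fun b _ => hcyl _ _) hdisj fun b _ => hint.integrableOn
      rw [h3, h1, h2, ← Finset.sum_sub_distrib, Finset.mul_sum]
      refine (Finset.abs_sum_le_sum_abs _ _).trans (Finset.sum_le_sum fun b _ => ?_)
      have := ih (n + 1) (Function.update ω n b)
      rwa [show n + 1 + k = n + (k + 1) by ring] at this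
  have hlim : Tendsto (fun k => C' * ρ ^ (n + k) * ν.real (restrictPast ⁻¹' pastCyl n ω)) atTop
      (𝓝 (C' * 0 * ν.real (restrictPast ⁻¹' pastCyl n ω))) := by
    refine ((Tendsto.const_mul _ ?_).mul_const _)
    simpa only [add_comm] using (tendsto_add_atTop_iff_nat n).2
      (tendsto_pow_atTop_nhds_zero_of_lt_one hρ0 hρ)
  have := ge_of_tendsto' hlim fun k => hbound k n ω
  rw [mul_zero, zero_mul, abs_nonpos_iff, sub_eq_zero] at this
  exact this

theorem ae_eq_condExp_of_cylinders {a : A} {P : Past A → ℝ} (hPm : Measurable P)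
    (hP0 : ∀ u, 0 ≤ P u) (hint : Integrable (fun η => P (restrictPast η)) ν)
    (h : ∀ n ω, ∫ η in restrictPast ⁻¹' pastCyl n ω, P (restrictPast η) ∂ν =
      ν.real (restrictPast ⁻¹' pastCyl n ω ∩ {η | η 0 = a})) :
    (fun η => P (restrictPast η)) =ᵐ[ν]
      ν[Set.indicator {ω : ZSeq A | ω 0 = a} (fun _ => (1 : ℝ)) | pastSigma A] := by
  have hE : MeasurableSet {η : ZSeq A | η 0 = a} := measurableSet_letter a
  have hfin : IsFiniteMeasure (ν.withDensity fun η => ENNReal.ofReal (P (restrictPast η))) :=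
    isFiniteMeasure_withDensity_ofReal hint.2
  have happ : ∀ s : Set (Past A), MeasurableSet s →
      ((ν.withDensity fun η => ENNReal.ofReal (P (restrictPast η))).map restrictPast) s =
        ENNReal.ofReal (∫ η in restrictPast ⁻¹' s, P (restrictPast η) ∂ν) := by
    intro s hs
    rw [Measure.map_apply measurable_restrictPast hs, withDensity_apply _
      (measurable_restrictPast hs), ofReal_integral_eq_lintegral_ofReal hint.integrableOn
      (ae_of_all _ fun η => hP0 _)]
  have happ2 : ∀ s : Set (Past A), MeasurableSet s →
      ((ν.restrict {η : ZSeq A | η 0 = a}).map restrictPast) s =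
        ENNReal.ofReal (ν.real (restrictPast ⁻¹' s ∩ {η | η 0 = a})) := by
    intro s hs
    rw [Measure.map_apply measurable_restrictPast hs, Measure.restrict_apply
      (measurable_restrictPast hs), ofReal_measureReal]
  have hcylP : ∀ n (ω : Past A),
      ((ν.withDensity fun η => ENNReal.ofReal (P (restrictPast η))).map restrictPast)
        (pastCyl n ω) = ((ν.restrict {η : ZSeq A | η 0 = a}).map restrictPast) (pastCyl n ω) := by
    intro n ω
    rw [happ _ (measurableSet_pastCyl n ω), happ2 _ (measurableSet_pastCyl n ω), h]
  have heq : (ν.withDensity fun η => ENNReal.ofReal (P (restrictPast η))).map restrictPast =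
      (ν.restrict {η : ZSeq A | η 0 = a}).map restrictPast := by
    refine ext_of_generate_finite _ generateFrom_pastCyl.symm isPiSystem_pastCyl ?_ ?_
    · rintro _ ⟨q, rfl⟩
      exact hcylP _ _
    · have : (Set.univ : Set (Past A)) = pastCyl 0 fun _ => a := by ext; simp [pastCyl]
      rw [this]
      exact hcylP _ _
  refine ae_eq_condExp_of_forall_setIntegral_eq pastSigma_le
    ((integrable_const 1).indicator hE) (fun s _ _ => hint.integrableOn) ?_ ?_
  · rintro _ ⟨s, hs, rfl⟩ -
    have h1 := congrArg (fun m : Measure (Past A) => m s) heq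
    simp only [happ s hs, happ2 s hs] at h1
    rw [ENNReal.ofReal_eq_ofReal_iff (integral_nonneg fun η => hP0 _) measureReal_nonneg] at h1
    rw [h1, setIntegral_indicator hE, setIntegral_const, smul_eq_mul, mul_one]
  · exact (hPm.comp (comap_measurable _)).aestronglyMeasurable

theorem exists_regular_gFunction [Nontrivial A] [TopologicalSpace A] [DiscreteTopology A]
    [BorelSpace A] {δ : ℝ} (hshift : ν.map shiftSeq = ν) (hδ0 : 0 < δ) (hρ0 : 0 ≤ ρ)
    (hρ : ρ < 1) (hpos : ∀ n ω, 0 < ν.real (restrictPast ⁻¹' pastCyl n ω))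
    (hδ : ∀ n a ω, δ ≤ stepProb ν n a ω)
    (hclose : ∀ m n ω ω' a, m ≤ n → (∀ j < m, ω j = ω' j) →
      |stepProb ν n a ω - stepProb ν n a ω'| ≤ C * ρ ^ m) :
    ∃ P : A → Past A → ℝ, IsGFunction P ∧ (∀ a, Continuous (P a)) ∧
      (∀ a ω, P a ω ∈ Set.Ioo (0 : ℝ) 1) ∧ Summable (fun m : ℕ => varG P (m + 1)) ∧
      IsGMeasure ν P := by
  have hstep := abs_stepProb_succ_sub_le hpos hclose
  have hlim : ∀ a ω, ∃ p, Tendsto (fun n => stepProb ν n a ω) atTop (𝓝 p) := fun a ω =>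
    cauchySeq_tendsto_of_complete (cauchySeq_of_le_geometric ρ C hρ fun n => hstep n a ω)
  choose P hP using hlim
  have hrate : ∀ n a ω, |stepProb ν n a ω - P a ω| ≤ C * ρ ^ n / (1 - ρ) := fun n a ω =>
    dist_le_of_le_geometric_of_tendsto ρ C hρ (fun n => hstep n a ω) (hP a ω) n
  have hvar : ∀ a m ω ω', (∀ j < m, ω j = ω' j) → |P a ω - P a ω'| ≤ C * ρ ^ m := by
    intro a m ω ω' h
    refine le_of_tendsto ((hP a ω).sub (hP a ω')).abs ?_
    filter_upwards [eventually_ge_atTop m] with n hn using hclose m n ω ω' a hn h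
  have hcont : ∀ a, Continuous (P a) := fun a => continuous_of_forall_abs_sub_le hρ0 hρ (hvar a)
  have hmeas : ∀ a, Measurable (P a) := fun a => (hcont a).measurable
  have hge : ∀ a ω, δ ≤ P a ω := fun a ω => ge_of_tendsto' (hP a ω) fun n => hδ n a ω
  have hsum : ∀ ω, ∑ a, P a ω = 1 := fun ω =>
    tendsto_nhds_unique (tendsto_finsetSum _ fun a _ => hP a ω)
      (by simp only [sum_stepProb hpos]; exact tendsto_const_nhds)
  have hlt : ∀ a ω, P a ω < 1 := by
    classical
    intro a ω
    obtain ⟨b, hb⟩ := exists_ne a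
    have h1 : ∑ c ∈ ({a, b} : Finset A), P c ω ≤ ∑ c, P c ω :=
      Finset.sum_le_sum_of_subset_of_nonneg (Finset.subset_univ _)
        fun c _ _ => hδ0.le.trans (hge c ω)
    rw [Finset.sum_pair hb.symm, hsum] at h1
    linarith [hge b ω]
  have hP0 : ∀ a ω, 0 ≤ P a ω := fun a ω => hδ0.le.trans (hge a ω)
  have hint : ∀ a, Integrable (fun η => P a (restrictPast η)) ν := fun a =>
    Integrable.of_bound ((hmeas a).comp measurable_restrictPast).aestronglyMeasurable 1
      (ae_of_all _ fun η => by
        rw [Real.norm_eq_abs, abs_of_nonneg (hP0 a _)]; exact (hlt a _).le)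
  have hcyl : ∀ a n ω, ∀ u ∈ pastCyl n ω,
      |P a u - stepProb ν n a ω| ≤ (C + C / (1 - ρ)) * ρ ^ n := by
    intro a n ω u hu
    have h1 := hvar a n u ω hu
    have h2 := hrate n a ω
    rw [abs_sub_comm] at h2
    calc |P a u - stepProb ν n a ω| ≤ |P a u - P a ω| + |P a ω - stepProb ν n a ω| :=
          abs_sub_le _ _ _
      _ ≤ C * ρ ^ n + C * ρ ^ n / (1 - ρ) := add_le_add h1 h2
      _ = (C + C / (1 - ρ)) * ρ ^ n := by ring
  refine ⟨P, ⟨hmeas, fun ω => ⟨hsum ω, fun a => ⟨hP0 a ω, (hlt a ω).le⟩⟩⟩, hcont,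
    fun a ω => ⟨hδ0.trans_le (hge a ω), hlt a ω⟩, ?_, inferInstance, hshift, fun a => ?_⟩
  · obtain ⟨a, -⟩ := exists_pair_ne A
    have hC : ∀ m, 0 ≤ C * ρ ^ m := fun m =>
      (abs_nonneg _).trans (hvar a m (fun _ => a) (fun _ => a) fun _ _ => rfl)
    refine Summable.of_nonneg_of_le (fun m => Real.sSup_nonneg ?_) (fun m => Real.sSup_le ?_ (hC _))
      ((summable_nat_add_iff 1).2 ((summable_geometric_of_lt_one hρ0 hρ).mul_left C))
    · rintro _ ⟨b, ω, ω', -, rfl⟩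
      exact abs_nonneg _
    · rintro _ ⟨b, ω, ω', h, rfl⟩
      exact hvar b (m + 1) ω ω' h
  · exact ae_eq_condExp_of_cylinders (hmeas a) (hP0 a) (hint a)
      (setIntegral_pastCyl_eq hρ0 hρ hpos (hint a) (hcyl a))

end Criterion

/-! ### The decimated projection -/

theorem cyl_union {S A T B : Finset Site} (hST : Disjoint S T) (hA : A ⊆ S) (hB : B ⊆ T) :
    cyl (S ∪ T) (A ∪ B) = cyl S A ∩ cyl T B := by
  have hS : ∀ i ∈ S, cfg (A ∪ B) i = cfg A i := fun i hi => by
    have : i ∉ B := fun h => Finset.disjoint_left.1 hST hi (hB h)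
    simp [cfg, this]
  have hT : ∀ i ∈ T, cfg (A ∪ B) i = cfg B i := fun i hi => by
    have : i ∉ A := fun h => Finset.disjoint_left.1 hST (hA h) hi
    simp [cfg, this]
  ext η
  simp only [cyl, Set.mem_ofPred_eq, Set.mem_inter_iff, Finset.mem_union, or_imp, forall_and]
  exact and_congr (forall₂_congr fun i hi => by rw [hS i hi])
    (forall₂_congr fun i hi => by rw [hT i hi])

/-- The site carrying the `r`-th spin of the letter at coordinate `-j`. -/
def letterSite (l k : ℕ) : ℕ × Fin l ↪ Site where
  toFun p := (-(p.1 : ℤ) * ((k : ℤ) + l) + p.2, 0)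
  inj' := by
    rintro ⟨i, r⟩ ⟨j, s⟩ h
    have h1 : -(i : ℤ) * ((k : ℤ) + l) + r = -(j : ℤ) * ((k : ℤ) + l) + s := congrArg Prod.fst h
    have hr := r.2
    have hs := s.2
    have hpos : (0 : ℤ) < (k : ℤ) + l := by omega
    have hr0 : (r : ℤ) / ((k : ℤ) + l) = 0 := Int.ediv_eq_zero_of_lt (by omega) (by omega)
    have hs0 : (s : ℤ) / ((k : ℤ) + l) = 0 := Int.ediv_eq_zero_of_lt (by omega) (by omega)
    have h2 := congrArg (· / ((k : ℤ) + l)) h1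
    simp only [add_comm _ (r : ℤ), add_comm _ (s : ℤ)] at h2
    rw [Int.add_mul_ediv_right _ _ hpos.ne', Int.add_mul_ediv_right _ _ hpos.ne', hr0, hs0] at h2
    have hij : i = j := by omega
    subst hij
    have hrs : r = s := Fin.ext (by omega)
    rw [hrs]

theorem letterSite_apply (l k j : ℕ) (r : Fin l) :
    letterSite l k (j, r) = (-(j : ℤ) * ((k : ℤ) + l) + r, 0) := rfl

/-- The sites of the letters at coordinates `-j`, `j ∈ J`. -/
def letterSites (l k : ℕ) (J : Finset ℕ) : Finset Site :=
  (J ×ˢ Finset.univ).map (letterSite l k)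

/-- The minus sites of the word `w` on the letters at coordinates `-j`, `j ∈ J`. -/
def minusSites (l k : ℕ) (J : Finset ℕ) (w : ℕ → Fin l → Bool) : Finset Site :=
  ((J ×ˢ Finset.univ).filter fun p => w p.1 p.2 = false).map (letterSite l k)

section Decimation

variable {l k : ℕ}

theorem minusSites_subset (J : Finset ℕ) (w : ℕ → Fin l → Bool) :
    minusSites l k J w ⊆ letterSites l k J :=
  Finset.map_subset_map.2 (Finset.filter_subset _ _)

theorem cyl_letterSites (J : Finset ℕ) (w : ℕ → Fin l → Bool) :
    cyl (letterSites l k J) (minusSites l k J w) =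
      {η | ∀ j ∈ J, ∀ r, η (letterSite l k (j, r)) = w j r} := by
  have hcfg : ∀ j ∈ J, ∀ r, cfg (minusSites l k J w) (letterSite l k (j, r)) = w j r := by
    intro j hj r
    simp only [cfg, minusSites, Finset.mem_map', Finset.mem_filter, Finset.mem_product, hj,
      Finset.mem_univ, true_and]
    cases w j r <;> rfl
  ext η
  simp only [cyl, letterSites, Finset.forall_mem_map, Set.mem_ofPred_eq]
  constructor
  · intro h j hj r
    rw [h (j, r) (by simp [hj]), hcfg j hj]
  · rintro h ⟨j, r⟩ hp
    have hj : j ∈ J := by simpa using hp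
    rw [h j hj, hcfg j hj]

theorem disjoint_letterSites {J J' : Finset ℕ} (h : Disjoint J J') :
    Disjoint (letterSites l k J) (letterSites l k J') :=
  (Finset.disjoint_map _).2 (Finset.disjoint_product.2 (Or.inl h))

/-- The law of the letters `(η(j(k+l)), …, η(j(k+l)+l-1))`, `j ∈ ℤ`. -/
noncomputable def letterLaw (l k : ℕ) (μ : Measure Cfg2) : Measure (ZSeq (Fin l → Bool)) :=
  (schonmann μ).map (blockMap l k)

variable {β : ℝ} {μ : Measure Cfg2}

theorem measurable_lineProj : Measurable lineProj :=
  measurable_pi_lambda _ fun _ => measurable_pi_apply _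

theorem measurable_blockMap : Measurable (blockMap l k) :=
  measurable_pi_lambda _ fun _ => measurable_pi_lambda _ fun _ => measurable_pi_apply _

theorem letterLaw_eq : letterLaw l k μ = μ.map (blockMap l k ∘ lineProj) :=
  Measure.map_map measurable_blockMap measurable_lineProj

theorem letterLaw_map_shiftSeq (h : IsPlusPhase β 0 μ) (ht1 : Real.exp (-β / 2) ≤ 1) :
    (letterLaw l k μ).map shiftSeq = letterLaw l k μ := by
  have hs : Measurable (shiftSeq : ZSeq (Fin l → Bool) → ZSeq (Fin l → Bool)) :=
    measurable_pi_lambda _ fun _ => measurable_pi_apply _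
  have hv : Measurable fun (η : Cfg2) (x : Site) => η (x + ((k : ℤ) + l, 0)) :=
    measurable_pi_lambda _ fun _ => measurable_pi_apply _
  have hm : Measurable (blockMap l k ∘ lineProj) := measurable_blockMap.comp measurable_lineProj
  rw [letterLaw_eq, Measure.map_map hs hm]
  conv_rhs => rw [← phase_map_add h ht1 ((k : ℤ) + l, 0), Measure.map_map hm hv]
  congr 1
  funext η j r
  simp only [Function.comp, shiftSeq, blockMap, lineProj, Prod.mk_add_mk, add_zero]
  congr 2
  ring

/-- The word reading the past `ω` at the letters `1, 2, …`. -/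
def pastWord (ω : Past (Fin l → Bool)) : ℕ → Fin l → Bool := fun j => ω (j - 1)

theorem restrictPast_blockMap (η : Cfg2) (j : ℕ) (r : Fin l) :
    restrictPast ((blockMap l k ∘ lineProj) η) j r = η (letterSite l k (j + 1, r)) := by
  rw [letterSite_apply, Nat.cast_add, Nat.cast_one]
  rfl

theorem preimage_pastCyl (n : ℕ) (ω : Past (Fin l → Bool)) :
    (blockMap l k ∘ lineProj) ⁻¹' (restrictPast ⁻¹' pastCyl n ω) =
      cyl (letterSites l k (Finset.Icc 1 n)) (minusSites l k (Finset.Icc 1 n) (pastWord ω)) := by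
  rw [cyl_letterSites]
  ext η
  simp only [pastCyl, Set.mem_preimage, Set.mem_ofPred_eq, Finset.mem_Icc, pastWord,
    funext_iff (α := Fin l)]
  constructor
  · rintro h j ⟨h1, h2⟩ r
    obtain ⟨i, rfl⟩ : ∃ i, j = i + 1 := ⟨j - 1, by omega⟩
    refine (restrictPast_blockMap η i r).symm.trans ?_
    exact h i (by omega) r
  · intro h j hj r
    exact (restrictPast_blockMap η j r).trans (h (j + 1) ⟨by omega, by omega⟩ r)

theorem preimage_letter (a : Fin l → Bool) :
    (blockMap l k ∘ lineProj) ⁻¹' {η | η 0 = a} =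
      cyl (letterSites l k {0}) (minusSites l k {0} fun _ => a) := by
  rw [cyl_letterSites]
  ext η
  simp [blockMap, lineProj, letterSite, funext_iff]

theorem letterLaw_pastCyl (n : ℕ) (ω : Past (Fin l → Bool)) :
    (letterLaw l k μ).real (restrictPast ⁻¹' pastCyl n ω) =
      μ.real (cyl (letterSites l k (Finset.Icc 1 n))
        (minusSites l k (Finset.Icc 1 n) (pastWord ω))) := by
  rw [letterLaw_eq, map_measureReal_apply (measurable_blockMap.comp measurable_lineProj)
    (measurable_restrictPast (measurableSet_pastCyl n ω)), preimage_pastCyl]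

theorem disjoint_past_letter (n : ℕ) :
    Disjoint (letterSites l k (Finset.Icc 1 n)) (letterSites l k {0}) :=
  disjoint_letterSites (by simp)

theorem stepProb_letterLaw (n : ℕ) (a : Fin l → Bool) (ω : Past (Fin l → Bool)) :
    stepProb (letterLaw l k μ) n a ω =
      μ.real (cyl (letterSites l k (Finset.Icc 1 n) ∪ letterSites l k {0})
          (minusSites l k (Finset.Icc 1 n) (pastWord ω) ∪ minusSites l k {0} fun _ => a)) /
        μ.real (cyl (letterSites l k (Finset.Icc 1 n))
          (minusSites l k (Finset.Icc 1 n) (pastWord ω))) := by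
  rw [stepProb, letterLaw_pastCyl, cyl_union (disjoint_past_letter n) (minusSites_subset _ _)
    (minusSites_subset _ _), ← preimage_pastCyl, ← preimage_letter, ← Set.preimage_inter,
    letterLaw_eq, map_measureReal_apply (measurable_blockMap.comp measurable_lineProj)
    ((measurable_restrictPast (measurableSet_pastCyl n ω)).inter (measurableSet_letter a))]

theorem card_letterSites_zero : (letterSites l k {0}).card = l := by simp [letterSites]

theorem letterSites_fst_emod (J : Finset ℕ) :
    ∀ s ∈ letterSites l k J, s.2 = 0 ∧ s.1 % ((k + l : ℕ) : ℤ) < l := by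
  simp only [letterSites, Finset.forall_mem_map]
  rintro ⟨j, r⟩ -
  refine ⟨rfl, ?_⟩
  have hr := r.2
  simp only [letterSite_apply, Nat.cast_add]
  rw [add_comm, Int.add_mul_emod_self_right, Int.emod_eq_of_lt (by omega) (by omega)]
  omega

theorem le_dist_of_agree {m n : ℕ} {ω ω' : Past (Fin l → Bool)} (h : ∀ j < m, ω j = ω' j) :
    ∀ b ∈ symmDiff (minusSites l k (Finset.Icc 1 n) (pastWord ω))
        (minusSites l k (Finset.Icc 1 n) (pastWord ω')), ∀ x ∈ letterSites l k {0},
      ((m * (k + l) : ℕ) : ℤ) ≤ |b.1 - x.1| := by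
  have key : ∀ j r, m < j → ∀ s : Fin l, ((m * (k + l) : ℕ) : ℤ) ≤
      |(letterSite l k (j, r)).1 - (letterSite l k (0, s)).1| := by
    intro j r hj s
    have hr := r.2
    have hs := s.2
    have : ((m : ℤ) + 1) * ((k : ℤ) + l) ≤ j * ((k : ℤ) + l) :=
      mul_le_mul_of_nonneg_right (by omega) (by omega)
    simp only [letterSite_apply]
    refine le_trans ?_ (neg_le_abs _)
    push_cast
    nlinarith
  have hmem : ∀ j r, j ∈ Finset.Icc 1 n → pastWord ω j r ≠ pastWord ω' j r → m < j := by
    intro j r hj hne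
    by_contra hm
    exact hne (by rw [pastWord, pastWord, h (j - 1) (by simp at hj; omega)])
  intro b hb x hx
  simp only [letterSites, Finset.mem_map, Finset.mem_product, Finset.mem_singleton,
    Finset.mem_univ, and_true, Prod.exists] at hx
  obtain ⟨i, s, rfl, rfl⟩ := hx
  obtain ⟨⟨j, r⟩, rfl⟩ : ∃ p, letterSite l k p = b := by
    rcases Finset.mem_symmDiff.1 hb with ⟨hb, -⟩ | ⟨hb, -⟩ <;>
      exact (Finset.mem_map.1 hb).imp fun _ hp => hp.2
  simp only [minusSites, Finset.mem_symmDiff, Finset.mem_map', Finset.mem_filter,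
    Finset.mem_product] at hb
  refine key j r (hmem j r (by tauto) fun he => ?_) s
  rw [he] at hb
  tauto

theorem stepProb_letterLaw_mem_Icc [IsFiniteMeasure μ] (n : ℕ) (a : Fin l → Bool)
    (ω : Past (Fin l → Bool)) : stepProb (letterLaw l k μ) n a ω ∈ Set.Icc (0 : ℝ) 1 := by
  have : IsFiniteMeasure (letterLaw l k μ) := by
    rw [letterLaw_eq]; infer_instance
  exact ⟨div_nonneg measureReal_nonneg measureReal_nonneg,
    div_le_one_of_le₀ (measureReal_mono Set.inter_subset_left) measureReal_nonneg⟩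

theorem abs_stepProb_letterLaw_sub_le (h : IsPlusPhase β 0 μ)
    (ht2 : 13122 * Real.exp (-β / 2) ≤ 1 / 2) (hl : 0 < l) (hk : 32 * l < k + l) (m n : ℕ)
    (ω ω' : Past (Fin l → Bool)) (a : Fin l → Bool) (hω : ∀ j < m, ω j = ω' j) :
    |stepProb (letterLaw l k μ) n a ω - stepProb (letterLaw l k μ) n a ω'| ≤
      (4 * l) * (1 / 2) ^ m := by
  have := h.1
  rcases lt_or_ge m 2 with hm | hm
  · have h1 := stepProb_letterLaw_mem_Icc (μ := μ) (k := k) n a ω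
    have h2 := stepProb_letterLaw_mem_Icc (μ := μ) (k := k) n a ω'
    have h3 : ((1 : ℝ) / 2) ^ 1 ≤ (1 / 2) ^ m :=
      pow_le_pow_of_le_one (by norm_num) (by norm_num) (by omega)
    have h4 : (1 : ℝ) ≤ l := by exact_mod_cast hl
    refine (abs_sub_le_of_le_of_le h1.1 h1.2 h2.1 h2.2).trans ?_
    nlinarith
  · rw [stepProb_letterLaw, stepProb_letterLaw]
    refine (phase_ratio_sub_le h ht2 hk (letterSites_fst_emod _) (disjoint_past_letter n)
      (minusSites_subset _ _) (minusSites_subset _ _) (minusSites_subset _ _)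
      (d := m * (k + l)) (by nlinarith) (le_dist_of_agree hω)).trans ?_
    have h3 : ((1 : ℝ) / 2) ^ (m * (k + l)) ≤ (1 / 2) ^ m :=
      pow_le_pow_of_le_one (by norm_num) (by norm_num) (Nat.le_mul_of_pos_right _ (by omega))
    rw [card_letterSites_zero]
    nlinarith [(Nat.cast_nonneg l : (0 : ℝ) ≤ l)]

theorem exists_regular_gFunction_letterLaw (h : IsPlusPhase β 0 μ)
    (ht2 : 13122 * Real.exp (-β / 2) ≤ 1 / 2) (hl : 0 < l) (hk : 32 * l < k + l) :
    ∃ P : (Fin l → Bool) → Past (Fin l → Bool) → ℝ,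
      IsGFunction P ∧ (∀ a, Continuous (P a)) ∧ (∀ a ω, P a ω ∈ Set.Ioo (0 : ℝ) 1) ∧
      Summable (fun m : ℕ => varG P (m + 1)) ∧ IsGMeasure (letterLaw l k μ) P := by
  have := h.1
  have : Nonempty (Fin l) := ⟨⟨0, hl⟩⟩
  have : IsProbabilityMeasure (letterLaw l k μ) := by
    rw [letterLaw_eq]
    exact Measure.isProbabilityMeasure_map
      (measurable_blockMap.comp measurable_lineProj).aemeasurable
  have ht := Real.exp_pos (-β / 2)
  have ht1 : Real.exp (-β / 2) ≤ 1 := by linarith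
  refine exists_regular_gFunction (C := 4 * l) (ρ := 1 / 2)
    (δ := (Real.exp (-β / 2) ^ 16 / 2) ^ l) (letterLaw_map_shiftSeq h ht1) (by positivity)
    (by norm_num) (by norm_num) (fun n ω => ?_) (fun n a ω => ?_)
    fun m n ω ω' a _ hω => abs_stepProb_letterLaw_sub_le h ht2 hl hk m n ω ω' a hω
  · rw [letterLaw_pastCyl]
    exact phase_cyl_pos h ht1 (minusSites_subset _ _)
  · rw [stepProb_letterLaw, le_div_iff₀ (phase_cyl_pos h ht1 (minusSites_subset _ _))]
    have := phase_finite_energy h ht1 (disjoint_past_letter (l := l) (k := k) n)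
      (minusSites_subset _ (pastWord ω)) (minusSites_subset _ fun _ => a)
    rwa [card_letterSites_zero] at this

end Decimation

end LowTemp

/-- For every `l` there is `K = K(l)` such that for every `k ≥ K` and all
sufficiently large `β`, the decimated Schonmann projection `ν_{l,k}^+` (viewed as a process on
the alphabet `{−1,+1}^l`) is a regular g-measure with summable variation. -/
theorem decimated_schonmann_regular_g_with_summable_variation
    (l : ℕ) (hl : 0 < l) :
    ∃ K : ℕ, ∀ k : ℕ, K ≤ k → ∃ β₀ : ℝ, ∀ β : ℝ, β₀ ≤ β →
      ∀ μp : Measure Cfg2, IsPlusPhase β 0 μp →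
        ∃ P : (Fin l → Bool) → Past (Fin l → Bool) → ℝ,
          IsGFunction P ∧ (∀ a, Continuous (P a)) ∧
          (∀ a ω, P a ω ∈ Set.Ioo (0 : ℝ) 1) ∧
          Summable (fun m : ℕ => varG P (m + 1)) ∧
          IsGMeasure ((schonmann μp).map (blockMap l k)) P := by
  refine ⟨32 * l, fun k hk => ⟨2 * Real.log 26244, fun β hβ μp hμ =>
    LowTemp.exists_regular_gFunction_letterLaw hμ ?_ hl (by omega)⟩⟩
  have h1 : Real.exp (-β / 2) ≤ Real.exp (-Real.log 26244) := Real.exp_le_exp.2 (by linarith)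
  rw [Real.exp_neg, Real.exp_log (by norm_num)] at h1
  linarith
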